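/- arXiv:2511.15662 — 6 statements merged into one kernel-verified Lean document; each statement's English description precedes it below -/
import Mathlib

section
/- For every C¹ function φ : ℝ/ℤ → ℝ, every point z ∈ ℝ/ℤ, and every integer n ≥ 1, the sum of φ over the Kⁿ preimages of z under fⁿ differs from the sum of φ over Fix(fⁿ) by at most ‖φ‖_{C⁰} + ‖φ'‖_{C⁰}; that is, |∑_{y ∈ f⁻ⁿ(z)} φ(y) − ∑_{p ∈ Fix(fⁿ)} φ(p)| ≤ ‖φ‖_{C⁰} + ‖φ'‖_{C⁰}, where preimages are counted with multiplicity. -/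
open MeasureTheory Filter

noncomputable section

/-- The set of periodic points of period `n` (not necessarily least period). -/
def FixPts (f : AddCircle (1:ℝ) → AddCircle (1:ℝ)) (n : ℕ) : Set (AddCircle (1:ℝ)) :=
  {p | f^[n] p = p}


theorem aux_surj (g : ℝ → ℝ) (hg : Continuous g) (M : ℝ) (hM : 1 ≤ M)
    (h : ∀ x, g (x + 1) = g x + M) : Function.Surjective g := by
  have h1 : ∀ k : ℕ, g k = g 0 + k * M := by
    intro k
    induction k with
    | zero => simp
    | succ k ih => push_cast; rw [h, ih]; ring
  have h2 : ∀ k : ℕ, g (-(k : ℝ)) = g 0 - k * M := by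
    intro k
    induction k with
    | zero => simp
    | succ k ih =>
      have := h (-((k : ℝ) + 1))
      rw [show -((k : ℝ) + 1) + 1 = -(k : ℝ) by ring, ih] at this
      push_cast
      linarith
  intro b
  apply mem_range_of_exists_le_of_exists_ge hg
  · obtain ⟨k, hk⟩ := exists_nat_ge (g 0 - b)
    refine ⟨-(k : ℝ), ?_⟩
    rw [h2]
    nlinarith [(Nat.cast_nonneg k : (0 : ℝ) ≤ k)]
  · obtain ⟨k, hk⟩ := exists_nat_ge (b - g 0)
    refine ⟨(k : ℝ), ?_⟩
    rw [h1]
    nlinarith [(Nat.cast_nonneg k : (0 : ℝ) ≤ k)]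

theorem aux_bdd (g : ℝ → ℝ) (hg : Continuous g) (h : ∀ x, g (x + 1) = g x) :
    BddAbove (Set.range fun x => |g x|) := by
  have hp : Function.Periodic (fun x => |g x|) 1 := fun x => by simp only [h]
  exact (hp.compact_of_continuous one_ne_zero hg.abs).bddAbove

theorem aux_coe {a b : ℝ} (h : (a : AddCircle (1:ℝ)) = (b : AddCircle (1:ℝ))) :
    ∃ k : ℤ, a = b + k := by
  rw [← sub_eq_zero, ← AddCircle.coe_sub, AddCircle.coe_eq_zero_iff] at h
  obtain ⟨k, hk⟩ := h
  refine ⟨k, ?_⟩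
  simp at hk
  linarith

theorem aux_coe_nat (a : ℝ) (k : ℕ) :
    ((a + k : ℝ) : AddCircle (1:ℝ)) = (a : AddCircle (1:ℝ)) := by
  rw [← sub_eq_zero, ← AddCircle.coe_sub, AddCircle.coe_eq_zero_iff]
  exact ⟨k, by simp⟩

theorem aux_lift (p : ℝ) (w : AddCircle (1:ℝ)) :
    ∃ x : ℝ, p ≤ x ∧ x < p + 1 ∧ (x : AddCircle (1:ℝ)) = w := by
  have : Fact ((0:ℝ) < 1) := ⟨one_pos⟩
  refine ⟨(AddCircle.equivIco 1 p w : ℝ), (AddCircle.equivIco 1 p w).2.1,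
    (AddCircle.equivIco 1 p w).2.2, ?_⟩
  exact (AddCircle.equivIco 1 p).symm_apply_apply w

/-- A finite sum over a subset of the circle parametrized by lifts in a fundamental domain. -/
theorem aux_sum (φ : AddCircle (1:ℝ) → ℝ) (S : Set (AddCircle (1:ℝ))) (p : ℝ) (N : ℕ)
    (y : ℕ → ℝ) (hy : ∀ i < N, p ≤ y i ∧ y i < p + 1) (hmono : StrictMono y)
    (hS : ∀ i < N, (y i : AddCircle (1:ℝ)) ∈ S)
    (hsurj : ∀ x : ℝ, p ≤ x → x < p + 1 → (x : AddCircle (1:ℝ)) ∈ S → ∃ i < N, y i = x) :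
    ∑ᶠ w ∈ S, φ w = ∑ i ∈ Finset.range N, φ (y i) := by
  have : Fact ((0:ℝ) < 1) := ⟨one_pos⟩
  rw [← finsum_mem_coe_finset]
  symm
  apply finsum_mem_eq_of_bijOn (fun i => (y i : AddCircle (1:ℝ)))
  · refine ⟨?_, ?_, ?_⟩
    · intro i hi
      exact hS i (by simpa using hi)
    · intro i hi j hj hij
      have hi' := hy i (by simpa using hi)
      have hj' := hy j (by simpa using hj)
      exact hmono.injective ((AddCircle.coe_eq_coe_iff_of_mem_Ico (a := p) hi' hj').1 hij)
    · intro w hw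
      obtain ⟨x, h1, h2, rfl⟩ := aux_lift p w
      obtain ⟨i, hi, rfl⟩ := hsurj x h1 h2 hw
      exact ⟨i, by simpa using hi, rfl⟩
  · intro i _
    rfl

/-- For every C¹ function `φ` (given by a C¹ lift `Φ`), every `z` and every `n ≥ 1`, the
sum of `φ` over the preimages of `z` under `fⁿ` differs from the sum of `φ` over
`Fix(fⁿ)` by at most `‖φ‖_C⁰ + ‖φ'‖_C⁰`. -/
theorem stmt2
    (K : ℕ) (hK : 2 ≤ K)
    (F : ℝ → ℝ) (hF : ContDiff ℝ 2 F)
    (hdeg : ∀ x : ℝ, F (x + 1) = F x + K)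
    (lam : ℝ) (hlam : 1 < lam)
    (hexp : ∀ x : ℝ, lam ≤ deriv F x)
    (f : AddCircle (1:ℝ) → AddCircle (1:ℝ))
    (hfF : ∀ x : ℝ, f (x : AddCircle (1:ℝ)) = ((F x : ℝ) : AddCircle (1:ℝ)))
    :
    ∀ (φ : AddCircle (1:ℝ) → ℝ) (Φ : ℝ → ℝ), ContDiff ℝ 1 Φ →
      (∀ x : ℝ, φ (x : AddCircle (1:ℝ)) = Φ x) →
      ∀ z : AddCircle (1:ℝ), ∀ n : ℕ, 1 ≤ n →
        |(∑ᶠ y ∈ (f^[n]) ⁻¹' {z}, φ y) - ∑ᶠ p ∈ FixPts f n, φ p| ≤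
          (⨆ x : ℝ, |Φ x|) + ⨆ x : ℝ, |deriv Φ x| := by
  intro φ Φ hΦ hφ z n hn
  -- the lift of the iterate
  have hFd : Differentiable ℝ F := hF.differentiable (by norm_num)
  have hFexp : ∀ x y, x < y → y - x < F y - F x := by
    intro x y hxy
    have := mul_sub_le_image_sub_of_le_deriv hFd hexp hxy.le
    nlinarith
  have hGexp : ∀ m : ℕ, ∀ x y, x < y → y - x < F^[m + 1] y - F^[m + 1] x := by
    intro m
    induction m with
    | zero => simpa using hFexp
    | succ m ih =>
      intro x y hxy
      have h1 := ih x y hxy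
      rw [Function.iterate_succ_apply' F (m + 1), Function.iterate_succ_apply' F (m + 1)]
      have h2 := hFexp (F^[m + 1] x) (F^[m + 1] y) (by linarith)
      linarith
  have hdegn : ∀ k : ℕ, ∀ x, F (x + k) = F x + k * K := by
    intro k
    induction k with
    | zero => simp
    | succ k ih => intro x; push_cast; rw [← add_assoc, hdeg, ih]; ring
  have hGdeg : ∀ m : ℕ, ∀ x, F^[m] (x + 1) = F^[m] x + ((K ^ m : ℕ) : ℝ) := by
    intro m
    induction m with
    | zero => simp
    | succ m ih =>
      intro x
      rw [Function.iterate_succ_apply', ih, hdegn, Function.iterate_succ_apply']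
      push_cast; ring
  have hfG : ∀ m : ℕ, ∀ x : ℝ, f^[m] (x : AddCircle (1:ℝ)) = ((F^[m] x : ℝ) : AddCircle (1:ℝ)) := by
    intro m
    induction m with
    | zero => simp
    | succ m ih =>
      intro x
      rw [Function.iterate_succ_apply', ih, hfF, Function.iterate_succ_apply']
  have hGc : Continuous F^[n] := hF.continuous.iterate n
  have hexpn : ∀ x y, x < y → y - x < F^[n] y - F^[n] x := by
    obtain ⟨m, rfl⟩ : ∃ m, n = m + 1 := ⟨n - 1, by omega⟩
    exact hGexp m
  have hKn : 2 ≤ K ^ n := le_trans hK (Nat.le_self_pow (by omega) K)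
  have hdegG := hGdeg n
  have hfGn := hfG n
  generalize F^[n] = G at hGc hexpn hdegG hfGn
  obtain ⟨M, hM⟩ : ∃ M, K ^ n = M + 1 := ⟨K ^ n - 1, by omega⟩
  have hM1 : 1 ≤ M := by omega
  have hM1' : (1 : ℝ) ≤ M := by exact_mod_cast hM1
  rw [hM] at hdegG
  push_cast at hdegG
  have hGs : StrictMono G := fun x y h => by have := hexpn x y h; linarith
  have hHs : StrictMono (fun x => G x - x) := fun x y h => by
    have := hexpn x y h
    show G x - x < G y - y
    linarith
  have hGsurj := aux_surj G hGc (M + 1) (by linarith) hdegG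
  have hHsurj := aux_surj (fun x => G x - x) (hGc.sub continuous_id) M hM1'
    (fun x => by simp only [hdegG]; ring)
  choose p hp using fun j : ℕ => hHsurj (j : ℝ)
  simp only at hp
  obtain ⟨t, ht0, ht1, rfl⟩ := aux_lift (p 0) z
  choose y hy using fun j : ℕ => hGsurj (t + j)
  have hpm : StrictMono p := by
    intro i j hij
    have : G (p i) - p i < G (p j) - p j := by
      rw [hp, hp]; exact_mod_cast hij
    exact hHs.lt_iff_lt.1 this
  have hym : StrictMono y := by
    intro i j hij
    have : G (y i) < G (y j) := by
      rw [hy, hy]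
      have : (i : ℝ) < j := by exact_mod_cast hij
      linarith
    exact hGs.lt_iff_lt.1 this
  have hp0 : G (p 0) - p 0 = 0 := by simpa using hp 0
  have hpM : p M = p 0 + 1 := by
    apply hHs.injective
    show G (p M) - p M = G (p 0 + 1) - (p 0 + 1)
    rw [hp, hdegG]; linarith
  have hpge : ∀ i, p 0 ≤ p i := fun i => hpm.monotone (Nat.zero_le i)
  have hple : ∀ i ≤ M, p i ≤ p 0 + 1 := fun i hi => hpM ▸ hpm.monotone hi
  have hsum1 : ∑ᶠ w ∈ (f^[n]) ⁻¹' {(t : AddCircle (1:ℝ))}, φ w =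
      ∑ i ∈ Finset.range (M + 1), φ (y i) := by
    apply aux_sum φ _ (p 0) (M + 1) y _ hym
    · intro i hi
      simp only [Set.mem_preimage, Set.mem_singleton_iff, hfGn, hy]
      exact aux_coe_nat t i
    · intro x hx0 hx1 hx
      simp only [Set.mem_preimage, Set.mem_singleton_iff, hfGn] at hx
      obtain ⟨k, hk⟩ := aux_coe hx
      have h1 := hGs.monotone hx0
      have h2 := hGs hx1
      rw [hdegG] at h2
      have h3 : (-1 : ℝ) < k := by linarith
      have h4 : (k : ℝ) < M + 1 := by linarith
      have h3' : (-1 : ℤ) < k := by exact_mod_cast h3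
      have h4' : k < M + 1 := by exact_mod_cast h4
      obtain ⟨i, rfl⟩ := Int.eq_ofNat_of_zero_le (show 0 ≤ k by omega)
      refine ⟨i, by omega, hGs.injective ?_⟩
      rw [hy, hk]; simp
    · intro i hi
      have hi0 : (0 : ℝ) ≤ i := Nat.cast_nonneg i
      have hi' : (i : ℝ) ≤ M := by exact_mod_cast (by omega : i ≤ M)
      constructor
      · apply hGs.le_iff_le.1
        rw [hy]; linarith
      · apply hGs.lt_iff_lt.1
        rw [hy, hdegG]; linarith
  have hsum2 : ∑ᶠ w ∈ FixPts f n, φ w = ∑ i ∈ Finset.range M, φ (p i) := by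
    apply aux_sum φ _ (p 0) M p _ hpm
    · intro i hi
      simp only [FixPts, Set.mem_setOf_eq, hfGn]
      rw [show G (p i) = p i + i by linarith [hp i]]
      exact aux_coe_nat _ i
    · intro x hx0 hx1 hx
      simp only [FixPts, Set.mem_setOf_eq, hfGn] at hx
      obtain ⟨k, hk⟩ := aux_coe hx
      have h1 : G (p 0) - p 0 ≤ G x - x := hHs.monotone hx0
      have h2 : G x - x < G (p 0 + 1) - (p 0 + 1) := hHs hx1
      rw [hdegG] at h2
      have h3 : (0 : ℝ) ≤ k := by linarith
      have h4 : (k : ℝ) < M := by linarith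
      have h3' : (0 : ℤ) ≤ k := by exact_mod_cast h3
      have h4' : k < M := by exact_mod_cast h4
      obtain ⟨i, rfl⟩ := Int.eq_ofNat_of_zero_le h3'
      refine ⟨i, by omega, hHs.injective ?_⟩
      show G (p i) - p i = G x - x
      rw [hp, hk]; simp
    · intro i hi
      exact ⟨hpge i, hpM ▸ hpm hi⟩
  -- interlacing
  have hint : ∀ i < M, |y i - p i| ≤ min (y (i + 1)) (p (i + 1)) - min (y i) (p i) := by
    intro i hi
    have a1 : y i ≤ y (i + 1) := hym.monotone (Nat.le_succ i)
    have a2 : p i ≤ p (i + 1) := hpm.monotone (Nat.le_succ i)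
    have a3 : y i ≤ p (i + 1) := by
      apply hGs.le_iff_le.1
      have := hp (i + 1)
      have := hpge (i + 1)
      push_cast at *
      rw [hy]; linarith
    have a4 : p i ≤ y (i + 1) := by
      apply hGs.le_iff_le.1
      have := hp i
      have := hple i hi.le
      rw [hy]; push_cast; linarith
    have : max (y i) (p i) ≤ min (y (i + 1)) (p (i + 1)) :=
      le_min (max_le a1 a4) (max_le a3 a2)
    have h := max_sub_min_eq_abs (y i) (p i)
    rw [abs_sub_comm] at h
    linarith
  have hy0 : p 0 ≤ y 0 := by
    apply hGs.le_iff_le.1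
    rw [hy]; push_cast; linarith
  have htot : ∑ i ∈ Finset.range M, |y i - p i| ≤ 1 := by
    calc _ ≤ ∑ i ∈ Finset.range M, (min (y (i + 1)) (p (i + 1)) - min (y i) (p i)) :=
          Finset.sum_le_sum fun i hi => hint i (Finset.mem_range.1 hi)
      _ = min (y M) (p M) - min (y 0) (p 0) :=
          Finset.sum_range_sub (fun i => min (y i) (p i)) M
      _ ≤ 1 := by
          have := min_le_right (y M) (p M)
          rw [min_eq_right hy0]
          linarith
  -- bounds on Φ
  have hΦp : ∀ x, Φ (x + 1) = Φ x := by
    intro x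
    rw [← hφ, ← hφ]
    congr 1
    simpa using aux_coe_nat x 1
  have hΦd : ∀ x, deriv Φ (x + 1) = deriv Φ x := by
    intro x
    rw [← deriv_comp_add_const]
    congr 1
    funext x
    exact hΦp x
  have hb0 := aux_bdd Φ hΦ.continuous hΦp
  have hb1 := aux_bdd (deriv Φ) (hΦ.continuous_deriv le_rfl) hΦd
  have hL : ∀ a b, |Φ a - Φ b| ≤ (⨆ x : ℝ, |deriv Φ x|) * |a - b| := by
    intro a b
    have := Convex.norm_image_sub_le_of_norm_deriv_le (f := Φ) (s := Set.univ)
      (C := ⨆ x : ℝ, |deriv Φ x|)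
      (fun x _ => (hΦ.differentiable (by norm_num)) x) (fun x _ => le_ciSup hb1 x)
      convex_univ (Set.mem_univ b) (Set.mem_univ a)
    simpa [Real.norm_eq_abs] using this
  have hC : 0 ≤ ⨆ x : ℝ, |deriv Φ x| := le_trans (abs_nonneg _) (le_ciSup hb1 0)
  rw [hsum1, hsum2, Finset.sum_range_succ, add_sub_right_comm, ← Finset.sum_sub_distrib]
  simp only [hφ]
  have h1 : |∑ i ∈ Finset.range M, (Φ (y i) - Φ (p i))| ≤ ⨆ x : ℝ, |deriv Φ x| := by
    calc _ ≤ ∑ i ∈ Finset.range M, |Φ (y i) - Φ (p i)| := Finset.abs_sum_le_sum_abs _ _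
      _ ≤ ∑ i ∈ Finset.range M, (⨆ x : ℝ, |deriv Φ x|) * |y i - p i| :=
          Finset.sum_le_sum fun i _ => hL _ _
      _ = (⨆ x : ℝ, |deriv Φ x|) * ∑ i ∈ Finset.range M, |y i - p i| := by
          rw [Finset.mul_sum]
      _ ≤ _ := mul_le_of_le_one_right hC htot
  have h2 : |Φ (y M)| ≤ ⨆ x : ℝ, |Φ x| := le_ciSup hb0 (y M)
  have h3 := abs_add_le (∑ i ∈ Finset.range M, (Φ (y i) - Φ (p i))) (Φ (y M))
  linarith
end
end

section
/- There exists a constant C > 0 such that for every point z ∈ ℝ/ℤ and every integer n ≥ 1, |E(χ_n) − (Kⁿ − 1)⁻¹ · ℒⁿh(z)| ≤ C·K⁻ⁿ. -/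
open MeasureTheory Filter

noncomputable section

/-- The transfer operator `ℒφ(x) = ∑_{f y = x} φ y`. -/
def transfer (f : AddCircle (1:ℝ) → AddCircle (1:ℝ)) (φ : AddCircle (1:ℝ) → ℝ) : AddCircle (1:ℝ) → ℝ :=
  fun x => ∑ᶠ y ∈ f ⁻¹' {x}, φ y

/-- The periodic Lyapunov exponent `χ_n(p) = (1/n) ∑_{k<n} log f'(fᵏ p)`. -/
def chi (f : AddCircle (1:ℝ) → AddCircle (1:ℝ)) (f' : AddCircle (1:ℝ) → ℝ) (n : ℕ) (p : AddCircle (1:ℝ)) : ℝ :=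
  (n : ℝ)⁻¹ * ∑ k ∈ Finset.range n, Real.log (f' (f^[k] p))

/-- Expectation with respect to the uniform probability measure on `FixPts f n`. -/
def Emean (f : AddCircle (1:ℝ) → AddCircle (1:ℝ)) (n : ℕ) (ψ : AddCircle (1:ℝ) → ℝ) : ℝ :=
  (Nat.card (FixPts f n) : ℝ)⁻¹ * ∑ᶠ p ∈ FixPts f n, ψ p

theorem aux_surj_s3 (H : ℝ → ℝ) (hc : Continuous H) (M : ℕ) (hM : 1 ≤ M)
    (hdeg : ∀ x, H (x + 1) = H x + M) (w : ℝ) : ∃ x, H x = w := by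
  have hM' : (1:ℝ) ≤ M := by exact_mod_cast hM
  have hup : ∀ k : ℕ, H k = H 0 + k * M := by
    intro k
    induction k with
    | zero => simp
    | succ k ih => push_cast; rw [hdeg, ih]; ring
  have hdn : ∀ k : ℕ, H (-(k:ℝ)) = H 0 - k * M := by
    intro k
    induction k with
    | zero => simp
    | succ k ih =>
      have := hdeg (-((k:ℝ)+1))
      rw [show -((k:ℝ)+1)+1 = -(k:ℝ) by ring, ih] at this
      push_cast
      linarith
  obtain ⟨k, hk⟩ := exists_nat_ge |w - H 0|
  have h1 := abs_le.mp hk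
  have hkM : (k:ℝ) ≤ k * M := le_mul_of_one_le_right (Nat.cast_nonneg k) hM'
  have := intermediate_value_Icc (a := -(k:ℝ)) (b := k)
    (by have := Nat.cast_nonneg (α := ℝ) k; linarith) hc.continuousOn
  have hw : w ∈ Set.Icc (H (-(k:ℝ))) (H k) := by
    rw [hup, hdn]; constructor <;> linarith [h1.1, h1.2]
  obtain ⟨x, -, hx⟩ := this hw
  exact ⟨x, hx⟩

theorem aux_enum (H : ℝ → ℝ) (hc : Continuous H) (hmono : StrictMono H) (M : ℕ) (hM : 1 ≤ M)
    (hdeg : ∀ x, H (x + 1) = H x + M) (a w : ℝ) (h1 : H a ≤ w) (h2 : w < H a + 1)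
    (S : Set (AddCircle (1:ℝ)))
    (hS : ∀ x : ℝ, (x : AddCircle (1:ℝ)) ∈ S ↔ ∃ m : ℤ, H x = w + m) :
    ∃ y : ℕ → ℝ, (∀ j, H (y j) = w + j) ∧
      Set.InjOn (fun j => (y j : AddCircle (1:ℝ))) (Finset.range M : Set ℕ) ∧
      S = (fun j => (y j : AddCircle (1:ℝ))) '' (Finset.range M : Set ℕ) := by
  choose y hy using fun j : ℕ => aux_surj_s3 H hc M hM hdeg (w + j)
  have hmem : ∀ j ∈ (Finset.range M : Set ℕ), y j ∈ Set.Ico a (a + 1) := by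
    intro j hj
    have hj' : (j:ℝ) + 1 ≤ M := by
      have : j < M := by simpa using hj
      exact_mod_cast this
    have h0 : (0:ℝ) ≤ j := Nat.cast_nonneg j
    constructor
    · rw [← hmono.le_iff_le, hy]; linarith
    · rw [← hmono.lt_iff_lt, hy, hdeg]; linarith
  have : Fact ((0:ℝ) < 1) := ⟨one_pos⟩
  refine ⟨y, hy, ?_, ?_⟩
  · intro i hi j hj hij
    have := (AddCircle.coe_eq_coe_iff_of_mem_Ico (hmem i hi) (hmem j hj)).mp hij
    have h3 := hy i
    rw [this, hy j] at h3
    have : (j:ℝ) = i := by linarith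
    exact_mod_cast this.symm
  · ext q
    constructor
    · intro hq
      obtain ⟨x, hx, rfl⟩ : ∃ x ∈ Set.Ico a (a+1), (x : AddCircle (1:ℝ)) = q := by
        have := AddCircle.coe_image_Ico_eq (1:ℝ) a
        have hq' : q ∈ ((↑) : ℝ → AddCircle (1:ℝ)) '' Set.Ico a (a+1) := by rw [this]; trivial
        exact hq'
      obtain ⟨m, hm⟩ := (hS x).mp hq
      have h3 : H a ≤ H x := hmono.monotone hx.1
      have h4 : H x < H a + M := by rw [← hdeg]; exact hmono hx.2
      have h5 : (-1:ℝ) < m := by linarith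
      have h6 : (m:ℝ) < M := by linarith
      have h5' : (-1:ℤ) < m := by exact_mod_cast h5
      have h6' : m < (M:ℤ) := by exact_mod_cast h6
      obtain ⟨k, rfl⟩ := Int.eq_ofNat_of_zero_le (by omega : 0 ≤ m)
      refine ⟨k, by simpa using h6', ?_⟩
      have : y k = x := hmono.injective (by rw [hy, hm]; simp)
      simp [this]
    · rintro ⟨j, hj, rfl⟩
      exact (hS _).mpr ⟨j, by simp [hy]⟩

theorem aux_sum_s3 (S : Set (AddCircle (1:ℝ))) (y : ℕ → ℝ) (M : ℕ)
    (hi : Set.InjOn (fun j => (y j : AddCircle (1:ℝ))) (Finset.range M : Set ℕ))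
    (hS : S = (fun j => (y j : AddCircle (1:ℝ))) '' (Finset.range M : Set ℕ))
    (φ : AddCircle (1:ℝ) → ℝ) :
    ∑ᶠ q ∈ S, φ q = ∑ j ∈ Finset.range M, φ (y j) := by
  rw [hS, finsum_mem_image hi, finsum_mem_coe_finset]

theorem aux_coe_s3 (x w : ℝ) : (x : AddCircle (1:ℝ)) = (w : AddCircle (1:ℝ)) ↔ ∃ m : ℤ, x = w + m := by
  rw [← sub_eq_zero, ← AddCircle.coe_sub, AddCircle.coe_eq_zero_iff]
  constructor
  · rintro ⟨m, hm⟩; exact ⟨m, by simp at hm; linarith⟩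
  · rintro ⟨m, hm⟩; exact ⟨m, by simp; linarith⟩

theorem aux_transfer (f : AddCircle (1:ℝ) → AddCircle (1:ℝ)) (hfin : ∀ n z, (f^[n] ⁻¹' {z}).Finite)
    (n : ℕ) : ∀ (φ : AddCircle (1:ℝ) → ℝ) (z : AddCircle (1:ℝ)),
    (transfer f)^[n] φ z = ∑ᶠ y ∈ f^[n] ⁻¹' {z}, φ y := by
  induction n with
  | zero => intro φ z; simp
  | succ n ih =>
    intro φ z
    rw [Function.iterate_succ_apply, ih]
    have : f^[n+1] ⁻¹' {z} = ⋃ y ∈ f^[n] ⁻¹' {z}, f ⁻¹' {y} := by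
      ext w; simp
    rw [this, finsum_mem_biUnion _ (hfin n z) (fun y _ => by simpa using hfin 1 y)]
    · rfl
    · intro a _ b _ hab
      refine Set.disjoint_left.mpr fun x hx hx' => hab ?_
      simp at hx hx'
      rw [← hx, hx']

theorem aux_mean (f : AddCircle (1:ℝ) → AddCircle (1:ℝ)) (f' : AddCircle (1:ℝ) → ℝ) (n : ℕ)
    (hn : 1 ≤ n) (hfin : (FixPts f n).Finite) :
    ∑ᶠ p ∈ FixPts f n, chi f f' n p = ∑ᶠ p ∈ FixPts f n, Real.log (f' p) := by
  have hb : Set.BijOn f (FixPts f n) (FixPts f n) := Function.bijOn_ptsOfPeriod f hn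
  have hk : ∀ k, ∑ᶠ p ∈ FixPts f n, Real.log (f' (f^[k] p)) =
      ∑ᶠ p ∈ FixPts f n, Real.log (f' p) := fun k =>
    finsum_mem_eq_of_bijOn (f^[k]) (hb.iterate k) (fun x _ => rfl)
  unfold chi
  rw [finsum_mem_eq_finite_toFinset_sum _ hfin, ← Finset.mul_sum, Finset.sum_comm]
  simp_rw [← finsum_mem_eq_finite_toFinset_sum _ hfin, hk]
  have : (n:ℝ) ≠ 0 := by positivity
  simp [this]

theorem aux_main (N M : ℕ) (hM : 1 ≤ M) (hN : N = M + 1) (G : ℝ → ℝ) (hc : Continuous G)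
    (hdeg : ∀ x, G (x + 1) = G x + N) (hexp : ∀ x y, x < y → y - x < G y - G x)
    (g : AddCircle (1:ℝ) → AddCircle (1:ℝ))
    (hg : ∀ x : ℝ, g (x : AddCircle (1:ℝ)) = ((G x : ℝ) : AddCircle (1:ℝ)))
    (φ : AddCircle (1:ℝ) → ℝ) (L B : ℝ) (hL0 : 0 ≤ L)
    (hL : ∀ x y : ℝ, |φ x - φ y| ≤ L * |x - y|) (hB : ∀ x, |φ x| ≤ B) (z : AddCircle (1:ℝ)) :
    (g ⁻¹' {z}).Finite ∧ {p | g p = p}.Finite ∧ Nat.card {p | g p = p} = M ∧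
    |∑ᶠ p ∈ {p | g p = p}, φ p - ∑ᶠ y ∈ g ⁻¹' {z}, φ y| ≤ L + B := by
  have hGm : StrictMono G := fun x y h => by linarith [hexp x y h]
  have hHm : StrictMono (fun x => G x - x) := fun x y h => by
    have := hexp x y h
    simp only; linarith
  have hHc : Continuous (fun x => G x - x) := hc.sub continuous_id
  have hHd : ∀ x, (fun x => G x - x) (x + 1) = (fun x => G x - x) x + M := fun x => by
    simp only [hdeg, hN]; push_cast; ring
  obtain ⟨a, ha⟩ := aux_surj_s3 _ hHc M hM hHd 0
  have ha' : G a = a := by linarith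
  obtain ⟨w, hw, rfl⟩ : ∃ x ∈ Set.Ico a (a+1), (x : AddCircle (1:ℝ)) = z := by
    have : Fact ((0:ℝ) < 1) := ⟨one_pos⟩
    have := AddCircle.coe_image_Ico_eq (1:ℝ) a
    have hq' : z ∈ ((↑) : ℝ → AddCircle (1:ℝ)) '' Set.Ico a (a+1) := by rw [this]; trivial
    exact hq'
  obtain ⟨p, hp, hpi, hpS⟩ := aux_enum _ hHc hHm M hM hHd a 0 ha.le (by rw [ha]; norm_num)
    {p | g p = p} (fun x => by
      simp only [Set.mem_ofPred_eq, hg, aux_coe_s3]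
      exact exists_congr fun m => by constructor <;> intro h <;> linarith)
  obtain ⟨y, hy, hyi, hyS⟩ := aux_enum G hc hGm N (by omega) hdeg a w (by rw [ha']; exact hw.1)
    (by rw [ha']; exact hw.2) (g ⁻¹' {(w : AddCircle (1:ℝ))}) (fun x => by
      simp only [Set.mem_preimage, Set.mem_singleton_iff, hg, aux_coe_s3])
  refine ⟨hyS ▸ (Finset.finite_toSet _).image _, hpS ▸ (Finset.finite_toSet _).image _, ?_, ?_⟩
  · rw [hpS, Nat.card_image_of_injOn hpi]; simp
  rw [aux_sum_s3 _ p M hpi hpS, aux_sum_s3 _ y N hyi hyS, hN, Finset.sum_range_succ, ← sub_sub,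
    ← Finset.sum_sub_distrib]
  choose u hu using fun j : ℕ => aux_surj_s3 G hc N (by omega) hdeg (a + j)
  have hu0 : u 0 = a := hGm.injective (by rw [hu, ha']; simp)
  have huM : u M ≤ a + 1 := by
    rw [← hGm.le_iff_le, hu, hdeg, ha', hN]; push_cast; linarith
  have hterm : ∀ j ∈ Finset.range M, |φ (p j) - φ (y j)| ≤ L * (u (j+1) - u j) := by
    intro j hj
    have hj' : (j:ℝ) + 1 ≤ M := by exact_mod_cast Finset.mem_range.mp hj
    have h0 : (0:ℝ) ≤ j := Nat.cast_nonneg j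
    have hpj : G (p j) - p j = 0 + j := hp j
    have p1 : a ≤ p j := by rw [← hHm.le_iff_le]; linarith
    have p2 : p j ≤ a + 1 := by rw [← hHm.le_iff_le]; rw [hdeg, hN]; push_cast; linarith
    have q1 : u j ≤ p j := by rw [← hGm.le_iff_le, hu]; linarith
    have q2 : p j ≤ u (j+1) := by rw [← hGm.le_iff_le, hu]; push_cast; linarith
    have q3 : u j ≤ y j := by rw [← hGm.le_iff_le, hu, hy]; linarith [hw.1]
    have q4 : y j ≤ u (j+1) := by rw [← hGm.le_iff_le, hu, hy]; push_cast; linarith [hw.2]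
    refine (hL _ _).trans (mul_le_mul_of_nonneg_left ?_ hL0)
    rw [abs_le]; constructor <;> linarith
  have hsum : |∑ j ∈ Finset.range M, (φ (p j) - φ (y j))| ≤ L := by
    refine (Finset.abs_sum_le_sum_abs _ _).trans ((Finset.sum_le_sum hterm).trans ?_)
    rw [← Finset.mul_sum, Finset.sum_range_sub, hu0]
    nlinarith
  exact (abs_sub _ _).trans (add_le_add hsum (hB _))

theorem aux_lip (F : ℝ → ℝ) (hF : ContDiff ℝ 2 F) (K : ℕ)
    (hdeg : ∀ x : ℝ, F (x + 1) = F x + K)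
    (lam : ℝ) (hlam : 1 < lam) (hexp : ∀ x : ℝ, lam ≤ deriv F x) :
    ∃ L B : ℝ, 0 ≤ L ∧ 0 ≤ B ∧
      (∀ x y, |Real.log (deriv F x) - Real.log (deriv F y)| ≤ L * |x - y|) ∧
      ∀ x, |Real.log (deriv F x)| ≤ B := by
  have hd : ContDiff ℝ 1 (deriv F) := ContDiff.deriv' (n := 1) (by rw [one_add_one_eq_two]; exact hF)
  set h : ℝ → ℝ := fun x => Real.log (deriv F x) with hh
  have hC : ContDiff ℝ 1 h := hd.log (fun x => by linarith [hexp x])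
  have hper : Function.Periodic h 1 := by
    intro x
    have : deriv F (x + 1) = deriv F x := by
      rw [← deriv_comp_add_const, funext hdeg, deriv_add_const]
    simp [hh, this]
  have hper' : Function.Periodic (deriv h) 1 := by
    intro x
    rw [← deriv_comp_add_const, funext hper]
  obtain ⟨L, hL⟩ := (hper'.isBounded_of_continuous one_ne_zero
    (hC.continuous_deriv le_rfl)).exists_norm_le
  obtain ⟨B, hB⟩ := (hper.isBounded_of_continuous one_ne_zero hC.continuous).exists_norm_le
  have hL' : ∀ x, ‖deriv h x‖ ≤ L := fun x => hL _ ⟨x, rfl⟩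
  have hB' : ∀ x, ‖h x‖ ≤ B := fun x => hB _ ⟨x, rfl⟩
  refine ⟨L, B, (norm_nonneg _).trans (hL' 0), (norm_nonneg _).trans (hB' 0), ?_, hB'⟩
  intro x y
  exact convex_univ.norm_image_sub_le_of_norm_deriv_le
    (fun x _ => (hC.differentiable one_ne_zero) x) (fun x _ => hL' x)
    (Set.mem_univ y) (Set.mem_univ x)

/-- There is `C > 0` with `|E(χ_n) - (Kⁿ - 1)⁻¹ ℒⁿh(z)| ≤ C K⁻ⁿ` for all `z` and `n ≥ 1`. -/
theorem stmt3
    (K : ℕ) (hK : 2 ≤ K)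
    (F : ℝ → ℝ) (hF : ContDiff ℝ 2 F)
    (hdeg : ∀ x : ℝ, F (x + 1) = F x + K)
    (lam : ℝ) (hlam : 1 < lam)
    (hexp : ∀ x : ℝ, lam ≤ deriv F x)
    (f : AddCircle (1:ℝ) → AddCircle (1:ℝ))
    (hfF : ∀ x : ℝ, f (x : AddCircle (1:ℝ)) = ((F x : ℝ) : AddCircle (1:ℝ)))
    (f' : AddCircle (1:ℝ) → ℝ)
    (hf'F : ∀ x : ℝ, f' (x : AddCircle (1:ℝ)) = deriv F x)
    :
    ∃ C : ℝ, 0 < C ∧ ∀ z : AddCircle (1:ℝ), ∀ n : ℕ, 1 ≤ n →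
      |Emean f n (chi f f' n) -
          ((K : ℝ) ^ n - 1)⁻¹ * (transfer f)^[n] (fun x => Real.log (f' x)) z| ≤
        C / (K : ℝ) ^ n := by
  obtain ⟨L, B, hL0, hB0, hL, hB⟩ := aux_lip F hF K hdeg lam hlam hexp
  set φ : AddCircle (1:ℝ) → ℝ := fun x => Real.log (f' x) with hφ
  have hφL : ∀ x y : ℝ, |φ x - φ y| ≤ L * |x - y| := fun x y => by
    simp only [hφ, hf'F]; exact hL x y
  have hφB : ∀ x, |φ x| ≤ B := fun x => by
    induction x using QuotientAddGroup.induction_on with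
    | H x => exact (by simp only [hφ, hf'F]; exact hB x : |φ (x : AddCircle (1:ℝ))| ≤ B)
  have hexpF : ∀ x y, x < y → y - x < F y - F x := by
    have : StrictMono (fun x => F x - x) := strictMono_of_deriv_pos fun x => by
      have hd : DifferentiableAt ℝ F x := (hF.differentiable two_ne_zero) x
      rw [deriv_fun_sub hd differentiableAt_fun_id]
      simp; linarith [hexp x]
    intro x y hxy
    have := this hxy
    simp only at this; linarith
  have hdegZ : ∀ (k : ℕ) (x : ℝ), F (x + k) = F x + k * K := by
    intro k x
    induction k with
    | zero => simp
    | succ k ih => push_cast; rw [← add_assoc, hdeg, ih]; ring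
  have hit : ∀ n : ℕ, (∀ x, F^[n] (x + 1) = F^[n] x + (K^n : ℕ)) ∧
      (∀ x y, x < y → y - x ≤ F^[n] y - F^[n] x) ∧
      (∀ x : ℝ, f^[n] (x : AddCircle (1:ℝ)) = ((F^[n] x : ℝ) : AddCircle (1:ℝ))) := by
    intro n
    induction n with
    | zero => simp
    | succ n ih =>
      obtain ⟨h1, h2, h3⟩ := ih
      simp only [Function.iterate_succ_apply']
      refine ⟨fun x => ?_, fun x y hxy => ?_, fun x => ?_⟩
      · rw [h1, hdegZ]; push_cast; ring
      · have := h2 x y hxy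
        have := hexpF (F^[n] x) (F^[n] y) (by linarith)
        linarith
      · rw [h3, hfF]
  have key : ∀ n : ℕ, 1 ≤ n → ∀ z, (f^[n] ⁻¹' {z}).Finite ∧ (FixPts f n).Finite ∧
      Nat.card (FixPts f n) = K^n - 1 ∧
      |∑ᶠ p ∈ FixPts f n, φ p - ∑ᶠ y ∈ f^[n] ⁻¹' {z}, φ y| ≤ L + B := by
    intro n hn z
    have hKn : 2 ≤ K^n := hK.trans (Nat.le_self_pow (by omega) K)
    refine aux_main (K^n) (K^n - 1) (by omega) (by omega) (F^[n])
      (hF.continuous.iterate n) (hit n).1 ?_ (f^[n]) (hit n).2.2 φ L B hL0 hφL hφB z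
    intro x y hxy
    obtain ⟨m, rfl⟩ : ∃ m, n = m + 1 := ⟨n - 1, by omega⟩
    simp only [Function.iterate_succ_apply]
    have h1 := hexpF x y hxy
    have := (hit m).2.1 (F x) (F y) (by linarith)
    linarith
  have hfin : ∀ n z, (f^[n] ⁻¹' {z}).Finite := by
    intro n z
    rcases Nat.eq_zero_or_pos n with rfl | hn
    · simp
    · exact (key n hn z).1
  refine ⟨2 * (L + B + 1), by linarith, fun z n hn => ?_⟩
  obtain ⟨-, k2, k3, k4⟩ := key n hn z
  have hKn : 2 ≤ K^n := hK.trans (Nat.le_self_pow (by omega) K)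
  have hKn' : (2:ℝ) ≤ (K:ℝ)^n := by exact_mod_cast hKn
  rw [aux_transfer f hfin, Emean, aux_mean f f' n hn k2, k3, Nat.cast_sub (by omega)]
  push_cast
  rw [← mul_sub, abs_mul, abs_of_pos (inv_pos.mpr (by linarith))]
  rw [inv_mul_eq_div, div_le_div_iff₀ (by linarith) (by linarith)]
  have k5 := mul_le_mul_of_nonneg_right k4 (by linarith : (0:ℝ) ≤ (K:ℝ)^n)
  refine k5.trans ?_
  nlinarith
end
end

section
/- There exist constants C > 0 and ξ ∈ (0,1) such that for every C¹ function φ : ℝ/ℤ → ℝ and every integer n ≥ 1, the function K⁻ⁿ·ℒⁿφ is C¹ and ‖K⁻ⁿ·ℒⁿφ − (∫ φ dμ)·𝟙‖_{C¹} ≤ C·ξⁿ·‖φ‖_{C¹}, where 𝟙 is the constant function 1. In particular, K⁻ⁿ·ℒⁿφ converges to the constant ∫ φ dμ exponentially fast in the C¹ norm. -/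
open MeasureTheory Filter

noncomputable section

lemma aux_coe_eq {a b : ℝ} (h : (a : AddCircle (1:ℝ)) = b) : ∃ m : ℤ, a = b + m := by
  rw [← sub_eq_zero, ← AddCircle.coe_sub, AddCircle.coe_eq_zero_iff] at h
  obtain ⟨m, hm⟩ := h
  refine ⟨m, ?_⟩
  simp at hm
  linarith

lemma aux_coe_add_int (a : ℝ) (m : ℤ) : ((a + m : ℝ) : AddCircle (1:ℝ)) = a := by
  rw [← sub_eq_zero, ← AddCircle.coe_sub, AddCircle.coe_eq_zero_iff]
  exact ⟨m, by simp⟩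

lemma aux_F_int {K : ℕ} {F : ℝ → ℝ} (hdeg : ∀ x : ℝ, F (x + 1) = F x + K) (m : ℤ) :
    ∀ x : ℝ, F (x + m) = F x + m * K := by
  induction m using Int.induction_on with
  | zero => simp
  | succ i ih =>
    intro x
    have := hdeg (x + (i : ℤ))
    push_cast at *
    rw [← add_assoc, this, ih]; ring
  | pred i ih =>
    intro x
    have h1 := hdeg (x + (-(i:ℝ) - 1))
    have h2 := ih x
    push_cast at *
    rw [show x + (-(i:ℝ) - 1) + 1 = x + -i by ring, h2] at h1
    linarith

lemma aux_inverse {K : ℕ} (hK : 2 ≤ K) {F : ℝ → ℝ} (hF : ContDiff ℝ 2 F)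
    (hdeg : ∀ x : ℝ, F (x + 1) = F x + K) {lam : ℝ} (hlam : 1 < lam)
    (hexp : ∀ x : ℝ, lam ≤ deriv F x) :
    ∃ H : ℝ → ℝ, (∀ x, F (H x) = x) ∧ (∀ x, H (F x) = x) ∧
      (∀ x, HasDerivAt H (deriv F (H x))⁻¹ x) ∧ Continuous (fun x => (deriv F (H x))⁻¹) := by
  have hpos : ∀ x, 0 < deriv F x := fun x => by linarith [hexp x]
  have hmono : StrictMono F := strictMono_of_deriv_pos hpos
  have hd : Differentiable ℝ F := hF.differentiable (by norm_num)
  have hdc : Continuous (deriv F) := hF.continuous_deriv (by norm_num)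
  have hK' : (2:ℝ) ≤ K := by exact_mod_cast hK
  have hsurj : Function.Surjective F := by
    intro y
    apply mem_range_of_exists_le_of_exists_ge hd.continuous
    · obtain ⟨m, hm⟩ := exists_nat_ge (F 0 - y)
      refine ⟨(0:ℝ) + ((-(m:ℤ) : ℤ) : ℝ), ?_⟩
      rw [aux_F_int hdeg]
      push_cast
      nlinarith [(Nat.cast_nonneg m : (0:ℝ) ≤ m)]
    · obtain ⟨m, hm⟩ := exists_nat_ge (y - F 0)
      refine ⟨(0:ℝ) + ((m:ℤ) : ℝ), ?_⟩
      rw [aux_F_int hdeg]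
      push_cast
      nlinarith [(Nat.cast_nonneg m : (0:ℝ) ≤ m)]
  let e := StrictMono.orderIsoOfSurjective F hmono hsurj
  have h1 : ∀ x, F (e.symm x) = x := fun x => e.apply_symm_apply x
  have h2 : ∀ x, e.symm (F x) = x := fun x => e.symm_apply_apply x
  have hc : Continuous e.symm := e.symm.continuous
  refine ⟨e.symm, h1, h2, fun x => ?_, ?_⟩
  · exact HasDerivAt.of_local_left_inverse hc.continuousAt (hd _).hasDerivAt (hpos _).ne'
      (Eventually.of_forall h1)
  · exact (hdc.comp hc).inv₀ fun x => (hpos _).ne'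

lemma aux_transfer_s4 {K : ℕ} (hK : 2 ≤ K) {F : ℝ → ℝ}
    (hdeg : ∀ x : ℝ, F (x + 1) = F x + K)
    {f : AddCircle (1:ℝ) → AddCircle (1:ℝ)}
    (hfF : ∀ x : ℝ, f (x : AddCircle (1:ℝ)) = ((F x : ℝ) : AddCircle (1:ℝ)))
    {H : ℝ → ℝ} (h1 : ∀ x, F (H x) = x) (h2 : ∀ x, H (F x) = x)
    (g : AddCircle (1:ℝ) → ℝ) (x : ℝ) :
    transfer f g x = ∑ j ∈ Finset.range K, g (H (x + j) : ℝ) := by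
  unfold transfer
  rw [← finsum_mem_coe_finset]
  symm
  apply finsum_mem_eq_of_bijOn (fun j : ℕ => ((H (x + j) : ℝ) : AddCircle (1:ℝ)))
  · refine ⟨?_, ?_, ?_⟩
    · intro j _
      simp only [Set.mem_preimage, Set.mem_singleton_iff, hfF, h1]
      exact_mod_cast aux_coe_add_int x j
    · intro i hi j hj hij
      obtain ⟨m, hm⟩ := aux_coe_eq hij
      have := congrArg F hm
      rw [aux_F_int hdeg, h1, h1] at this
      have h3 : (i:ℤ) = j + m * K := by
        have : (i:ℝ) = j + m * K := by linarith
        exact_mod_cast this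
      simp only [Finset.coe_range, Set.mem_Iio] at hi hj
      have h4 := congrArg (· % (K:ℤ)) h3
      simp only [Int.add_mul_emod_self_right] at h4
      rw [Int.emod_eq_of_lt (by omega) (by omega), Int.emod_eq_of_lt (by omega) (by omega)] at h4
      exact_mod_cast h4
    · intro y hy
      induction y using QuotientAddGroup.induction_on with
      | H t =>
      have hy' : ((F t : ℝ) : AddCircle (1:ℝ)) = x := by rw [← hfF]; exact hy
      obtain ⟨m, hm⟩ := aux_coe_eq hy'
      have hK0 : (K:ℤ) ≠ 0 := by omega
      have hj0 := Int.emod_nonneg m hK0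
      have hj1 := Int.emod_lt_of_pos m (show (0:ℤ) < K by omega)
      have hq := Int.emod_add_mul_ediv m K
      refine ⟨(m % K).toNat, ?_, ?_⟩
      · simp only [Finset.coe_range, Set.mem_Iio]; omega
      · have hc : (((m % K).toNat : ℕ) : ℝ) = ((m % K : ℤ) : ℝ) := by
          exact_mod_cast congrArg (Int.cast : ℤ → ℝ) (Int.toNat_of_nonneg hj0)
        have hq' : ((m % K : ℤ) : ℝ) + K * ((m / K : ℤ) : ℝ) = m := by exact_mod_cast hq
        have h5 : x + (((m % K).toNat : ℕ) : ℝ) = F (t + ((-(m / K) : ℤ) : ℝ)) := by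
          rw [aux_F_int hdeg, hc, hm]
          push_cast
          linarith
        show ((H (x + (((m % K).toNat : ℕ) : ℝ)) : ℝ) : AddCircle (1:ℝ)) = t
        rw [h5, h2]
        exact aux_coe_add_int t _
  · intro j _
    rfl

lemma aux_continuous {g : AddCircle (1:ℝ) → ℝ} {Γ : ℝ → ℝ} (hΓ : Continuous Γ)
    (hg : ∀ x : ℝ, g x = Γ x) : Continuous g := by
  apply continuous_coinduced_dom.2
  have : g ∘ (fun x : ℝ => (x : AddCircle (1:ℝ))) = Γ := funext hg
  exact this ▸ hΓ

lemma aux_bdd_s4 {Φ : ℝ → ℝ} (hΦ : ContDiff ℝ 1 Φ) (hp : ∀ x, Φ (x + 1) = Φ x) :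
    BddAbove (Set.range fun x => |deriv Φ x|) := by
  have hc : Continuous (deriv Φ) := hΦ.continuous_deriv (by norm_num)
  have hper : Function.Periodic (fun x => |deriv Φ x|) 1 := by
    intro x
    have : (fun y => Φ (y + 1)) = Φ := funext hp
    show |deriv Φ (x + 1)| = |deriv Φ x|
    rw [← deriv_comp_add_const, this]
  exact (hper.compact_of_continuous one_ne_zero hc.abs).bddAbove

/-- Spectral gap: there are `C > 0` and `ξ ∈ (0,1)` such that for every C¹ function `φ`
(given by a C¹ lift `Φ`) and every `n ≥ 1`, the function `K⁻ⁿℒⁿφ` is C¹ (it has a C¹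
lift `G`) and `‖K⁻ⁿℒⁿφ - (∫φ dμ)𝟙‖_C¹ ≤ C ξⁿ ‖φ‖_C¹`. -/
theorem stmt4
    (K : ℕ) (hK : 2 ≤ K)
    (F : ℝ → ℝ) (hF : ContDiff ℝ 2 F)
    (hdeg : ∀ x : ℝ, F (x + 1) = F x + K)
    (lam : ℝ) (hlam : 1 < lam)
    (hexp : ∀ x : ℝ, lam ≤ deriv F x)
    (f : AddCircle (1:ℝ) → AddCircle (1:ℝ))
    (hfF : ∀ x : ℝ, f (x : AddCircle (1:ℝ)) = ((F x : ℝ) : AddCircle (1:ℝ)))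
    (μ : Measure (AddCircle (1:ℝ))) [IsProbabilityMeasure μ]
    (hinv : ∀ φ : AddCircle (1:ℝ) → ℝ, Continuous φ → ∫ x, φ (f x) ∂μ = ∫ x, φ x ∂μ)
    (hμ : ∀ φ : AddCircle (1:ℝ) → ℝ, Continuous φ → ∫ x, transfer f φ x ∂μ = (K : ℝ) * ∫ x, φ x ∂μ)
    :
    ∃ C ξ : ℝ, 0 < C ∧ 0 < ξ ∧ ξ < 1 ∧
      ∀ (φ : AddCircle (1:ℝ) → ℝ) (Φ : ℝ → ℝ), ContDiff ℝ 1 Φ →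
        (∀ x : ℝ, φ (x : AddCircle (1:ℝ)) = Φ x) →
        ∀ n : ℕ, 1 ≤ n → ∃ G : ℝ → ℝ, ContDiff ℝ 1 G ∧
          (∀ x : ℝ, ((K : ℝ) ^ n)⁻¹ * (transfer f)^[n] φ (x : AddCircle (1:ℝ)) = G x) ∧
          (⨆ x : ℝ, |G x - ∫ y, φ y ∂μ|) + (⨆ x : ℝ, |deriv G x|) ≤
            C * ξ ^ n * ((⨆ x : ℝ, |Φ x|) + ⨆ x : ℝ, |deriv Φ x|) := by
  obtain ⟨H, h1, h2, hH, hHc⟩ := aux_inverse hK hF hdeg hlam hexp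
  have hK0 : (0:ℝ) < K := by exact_mod_cast (by omega : 0 < K)
  have hl0 : 0 < lam := by linarith
  refine ⟨2, lam⁻¹, by norm_num, by positivity, inv_lt_one_of_one_lt₀ hlam, ?_⟩
  intro φ Φ hΦ hφ n _
  have hp : ∀ x, Φ (x + 1) = Φ x := fun x => by
    rw [← hφ, ← hφ]; exact_mod_cast congrArg φ (aux_coe_add_int x 1)
  have hb := aux_bdd_s4 hΦ hp
  set D := ⨆ x : ℝ, |deriv Φ x| with hD
  have hD0 : 0 ≤ D := Real.iSup_nonneg fun x => abs_nonneg _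
  have key : ∀ n : ℕ, ∃ G : ℝ → ℝ, ContDiff ℝ 1 G ∧
      (∀ x : ℝ, (transfer f)^[n] φ (x : AddCircle (1:ℝ)) = G x) ∧
      (∀ x, |deriv G x| ≤ K ^ n * (lam⁻¹ ^ n * D)) ∧
      ∫ x, (transfer f)^[n] φ x ∂μ = K ^ n * ∫ x, φ x ∂μ := by
    intro n
    induction n with
    | zero => exact ⟨Φ, hΦ, hφ, fun x => by simpa using le_ciSup hb x, by simp⟩
    | succ n ih =>
      obtain ⟨G, hG, hGl, hGd, hGi⟩ := ih
      have hder : ∀ x, HasDerivAt (fun x => ∑ j ∈ Finset.range K, G (H (x + j)))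
          (∑ j ∈ Finset.range K, deriv G (H (x + j)) * (deriv F (H (x + j)))⁻¹) x := by
        intro x
        apply HasDerivAt.fun_sum
        intro j _
        have hHj : HasDerivAt (fun x => H (x + j)) (deriv F (H (x + j)))⁻¹ x :=
          HasDerivAt.comp_add_const x (j:ℝ) (hH (x + j))
        exact (((hG.differentiable (by norm_num)) (H (x + j))).hasDerivAt).comp x hHj
      have hHcont : Continuous H :=
        continuous_iff_continuousAt.2 fun x => (hH x).continuousAt
      have hGc : Continuous (deriv G) := hG.continuous_deriv (by norm_num)
      refine ⟨fun x => ∑ j ∈ Finset.range K, G (H (x + j)), ?_, ?_, ?_, ?_⟩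
      · rw [contDiff_one_iff_deriv]
        refine ⟨fun x => (hder x).differentiableAt, ?_⟩
        rw [show deriv (fun x => ∑ j ∈ Finset.range K, G (H (x + j))) = _ from
          funext fun x => (hder x).deriv]
        refine continuous_finset_sum _ fun j _ => ?_
        have ha : Continuous fun x : ℝ => x + j := by fun_prop
        exact (hGc.comp (hHcont.comp ha)).mul (hHc.comp ha)
      · intro x
        rw [Function.iterate_succ_apply', aux_transfer_s4 hK hdeg hfF h1 h2]
        simp [hGl]
      · intro x
        rw [(hder x).deriv]
        calc _ ≤ ∑ j ∈ Finset.range K, |deriv G (H (x + j)) * (deriv F (H (x + j)))⁻¹| :=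
              Finset.abs_sum_le_sum_abs _ _
          _ ≤ ∑ j ∈ Finset.range K, (K ^ n * (lam⁻¹ ^ n * D)) * lam⁻¹ := by
              refine Finset.sum_le_sum fun j _ => ?_
              have hq := hexp (H (x + j))
              rw [abs_mul, abs_of_pos (inv_pos.2 (by linarith : 0 < deriv F (H (x + j))))]
              refine mul_le_mul (hGd _) (inv_anti₀ hl0 hq) (inv_nonneg.2 (by linarith)) (by positivity)
          _ = _ := by simp; ring
      · rw [Function.iterate_succ_apply', hμ _ (aux_continuous hG.continuous hGl), hGi]
        ring
  obtain ⟨G, hG, hGl, hGd, hGi⟩ := key n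
  have hKn : (0:ℝ) < K ^ n := by positivity
  set c : ℝ := lam⁻¹ ^ n * D with hc
  have hc0 : 0 ≤ c := by positivity
  set I := ∫ y, φ y ∂μ with hI
  have hcont := aux_continuous hG.continuous hGl
  have hdG : Differentiable ℝ G := hG.differentiable (by norm_num)
  -- oscillation bound
  have hosc : ∀ x y : ℝ, |G x - G y| ≤ K ^ n * c := by
    intro x y
    obtain ⟨z, hz, hzx⟩ : ∃ z, G z = G y ∧ |x - z| ≤ 1 := by
      refine ⟨y + (⌊x - y⌋ : ℤ), ?_, ?_⟩
      · rw [← hGl, ← hGl, aux_coe_add_int]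
      · rw [abs_le]
        constructor <;> linarith [Int.floor_le (x - y), Int.lt_floor_add_one (x - y)]
    have := Convex.norm_image_sub_le_of_norm_deriv_le (f := G) (s := Set.univ)
      (C := K ^ n * c) (fun w _ => hdG w) (fun w _ => hGd w) convex_univ
      (Set.mem_univ z) (Set.mem_univ x)
    rw [Real.norm_eq_abs, Real.norm_eq_abs, hz] at this
    nlinarith [mul_nonneg hKn.le hc0]
  have hmean : ∀ x : ℝ, |G x - K ^ n * I| ≤ K ^ n * c := by
    intro x
    have hint : Integrable ((transfer f)^[n] φ) μ :=
      hcont.integrable_of_hasCompactSupport (HasCompactSupport.of_compactSpace _)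
    have e : G x - K ^ n * I = ∫ y, (G x - (transfer f)^[n] φ y) ∂μ := by
      rw [integral_sub (integrable_const _) hint, hGi]; simp
    rw [e, ← Real.norm_eq_abs]
    have := norm_integral_le_of_norm_le_const (μ := μ) (C := K ^ n * c)
      (f := fun y => G x - (transfer f)^[n] φ y) (Eventually.of_forall fun y => by
        induction y using QuotientAddGroup.induction_on with
        | H t => 
          have h := hosc x t
          rw [← hGl t] at h
          exact h)
    simpa using this
  refine ⟨fun x => ((K:ℝ) ^ n)⁻¹ * G x, contDiff_const.mul hG, fun x => by rw [hGl], ?_⟩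
  have hS : 0 ≤ ⨆ x : ℝ, |Φ x| := Real.iSup_nonneg fun x => abs_nonneg _
  have hA : (⨆ x : ℝ, |((K:ℝ) ^ n)⁻¹ * G x - I|) ≤ c := by
    refine ciSup_le fun x => ?_
    have e : ((K:ℝ) ^ n)⁻¹ * G x - I = ((K:ℝ) ^ n)⁻¹ * (G x - K ^ n * I) := by
      field_simp
    rw [e, abs_mul, abs_of_pos (inv_pos.2 hKn), inv_mul_le_iff₀ hKn]
    exact hmean x
  have hB : (⨆ x : ℝ, |deriv (fun x => ((K:ℝ) ^ n)⁻¹ * G x) x|) ≤ c := by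
    refine ciSup_le fun x => ?_
    rw [deriv_const_mul _ (hdG x), abs_mul, abs_of_pos (inv_pos.2 hKn), inv_mul_le_iff₀ hKn]
    exact hGd x
  have hl : 0 ≤ lam⁻¹ ^ n * ⨆ x : ℝ, |Φ x| := by positivity
  calc _ ≤ c + c := add_le_add hA hB
    _ ≤ _ := by rw [hc]; nlinarith
end
end

section
/- There exists a constant C > 0 such that for every integer n ≥ 1, |E(χ_n) − ∫ h dμ| ≤ C·K⁻ⁿ. In particular, E(χ_n) → ∫ h dμ as n → ∞. -/
open MeasureTheory Filter

noncomputable section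

lemma coe_eq_iff_int (x y : ℝ) :
    ((x : AddCircle (1:ℝ)) = (y : AddCircle (1:ℝ))) ↔ ∃ k : ℤ, x = y + k := by
  rw [← sub_eq_zero, ← AddCircle.coe_sub, AddCircle.coe_eq_zero_iff]
  constructor
  · rintro ⟨k, hk⟩
    refine ⟨k, ?_⟩
    simp at hk
    linarith
  · rintro ⟨k, hk⟩
    refine ⟨k, ?_⟩
    simp [hk]

lemma shift_int (E : ℝ → ℝ) (N : ℕ) (hE : ∀ x, E (x + 1) = E x + N) (k : ℤ) (x : ℝ) :
    E (x + k) = E x + k * N := by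
  induction k using Int.induction_on with
  | zero => simp
  | succ i ih =>
    push_cast at ih ⊢
    rw [← add_assoc, hE, ih]; ring
  | pred i ih =>
    push_cast at ih ⊢
    have := hE (x + (-(i:ℝ) - 1))
    rw [show x + (-(i:ℝ) - 1) + 1 = x + -(i:ℝ) by ring, ih] at this
    linarith

lemma enum_set (E : ℝ ≃o ℝ) (N : ℕ) (hN : 0 < N) (hE : ∀ x, E (x + 1) = E x + N) (t : ℝ)
    (S : Set (AddCircle (1:ℝ)))
    (hS : ∀ x : ℝ, ((x : AddCircle (1:ℝ)) ∈ S) ↔ ∃ m : ℤ, E x = t + m) :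
    ∃ s : Finset (AddCircle (1:ℝ)), S = ↑s ∧ s.card = N ∧
      ∀ φ : AddCircle (1:ℝ) → ℝ, ∑ p ∈ s, φ p =
        ∑ m ∈ Finset.range N, φ ((E.symm (t + (m:ℝ)) : ℝ) : AddCircle (1:ℝ)) := by
  classical
  set g : ℕ → AddCircle (1:ℝ) := fun m => ((E.symm (t + (m:ℝ)) : ℝ) : AddCircle (1:ℝ)) with hg
  have hinj : Set.InjOn g (Finset.range N : Set ℕ) := by
    intro a ha b hb hab
    obtain ⟨k, hk⟩ := (coe_eq_iff_int _ _).1 hab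
    have h1 := congrArg E hk
    rw [shift_int E N hE, E.apply_symm_apply, E.apply_symm_apply] at h1
    have h2 : (a:ℤ) = b + k * N := by
      have : (a:ℝ) = b + k * N := by linarith
      exact_mod_cast this
    simp only [Finset.coe_range, Set.mem_Iio] at ha hb
    have h3 : (a:ℤ) % N = (b:ℤ) % N := by rw [h2]; simp
    rw [Int.emod_eq_of_lt (by positivity) (by exact_mod_cast ha),
      Int.emod_eq_of_lt (by positivity) (by exact_mod_cast hb)] at h3
    exact_mod_cast h3
  refine ⟨(Finset.range N).image g, ?_, ?_, ?_⟩
  · ext p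
    induction p using QuotientAddGroup.induction_on with
    | H x =>
    simp only [Finset.coe_image, Set.mem_image, Finset.coe_range, Set.mem_Iio]
    constructor
    · intro hx
      obtain ⟨m, hm⟩ := (hS x).1 hx
      have hN' : (0:ℤ) < N := by exact_mod_cast hN
      refine ⟨(m % N).toNat, ?_, ?_⟩
      · have := Int.emod_lt_of_pos m hN'
        omega
      · refine (coe_eq_iff_int _ _).2 ⟨-(m / N), ?_⟩
        rw [E.symm_apply_eq, shift_int E N hE, hm]
        have h1 : (((m % N).toNat : ℤ)) = m % N := Int.toNat_of_nonneg (Int.emod_nonneg _ hN'.ne')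
        have h2 : (((m % N).toNat : ℝ)) = ((m % N : ℤ) : ℝ) := by exact_mod_cast h1
        have h3 : (m:ℝ) = ((m % N : ℤ) : ℝ) + N * ((m / N : ℤ) : ℝ) := by
          exact_mod_cast (Int.emod_add_mul_ediv m N).symm
        rw [h2, h3]
        push_cast
        have h4 : ((m % N + N * (m / N) : ℤ)) = m := Int.emod_add_mul_ediv m N
        linarith
    · rintro ⟨m, -, hm⟩
      rw [← hm]
      exact (hS _).2 ⟨m, by simp⟩
  · rw [Finset.card_image_of_injOn hinj, Finset.card_range]
  · intro φ
    rw [Finset.sum_image hinj]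

lemma sum_range_mul' (g : ℕ → ℝ) (K M : ℕ) :
    ∑ j ∈ Finset.range K, ∑ m ∈ Finset.range M, g (j + K * m) = ∑ i ∈ Finset.range (K * M), g i := by
  rw [Finset.sum_comm]
  induction M with
  | zero => simp
  | succ M ih =>
    rw [Finset.sum_range_succ, ih, Nat.mul_succ, Finset.sum_range_add]
    congr 1
    exact Finset.sum_congr rfl fun j _ => by rw [add_comm]

/-- The key estimate: comparison of two selections, one point per gap. -/
lemma gap_estimate (φ : ℝ → ℝ) (L : ℝ) (hL0 : 0 ≤ L) (hL : ∀ x y, |φ x - φ y| ≤ L * |x - y|)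
    (H : ℝ → ℝ) (hH : Monotone H) (Q : ℕ) (hQ : ∀ x, H (x + Q) = H x + 1) (c : ℝ)
    (N : ℕ) (hNQ : N ≤ Q) (x : ℕ → ℝ) (hx : ∀ m < N, c ≤ x m ∧ x m ≤ c + 1) :
    |∑ m ∈ Finset.range N, φ (H (x m + m)) - ∑ m ∈ Finset.range N, φ (H (c + m))| ≤ L := by
  rw [← Finset.sum_sub_distrib]
  calc |∑ m ∈ Finset.range N, (φ (H (x m + m)) - φ (H (c + m)))|
      ≤ ∑ m ∈ Finset.range N, |φ (H (x m + m)) - φ (H (c + m))| := Finset.abs_sum_le_sum_abs _ _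
    _ ≤ ∑ m ∈ Finset.range N, L * (H (c + ((m + 1 : ℕ) : ℝ)) - H (c + m)) := by
        refine Finset.sum_le_sum fun m hm => ?_
        obtain ⟨h1, h2⟩ := hx m (Finset.mem_range.1 hm)
        refine (hL _ _).trans (mul_le_mul_of_nonneg_left ?_ hL0)
        have h3 : H (c + m) ≤ H (x m + m) := hH (by linarith)
        have h4 : H (x m + m) ≤ H (c + ((m + 1 : ℕ) : ℝ)) := hH (by push_cast; linarith)
        rw [abs_of_nonneg (by linarith)]
        linarith
    _ = L * (H (c + N) - H c) := by
        rw [← Finset.mul_sum, Finset.sum_range_sub (fun m : ℕ => H (c + (m:ℝ)))]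
        simp
    _ ≤ L * 1 := by
        refine mul_le_mul_of_nonneg_left ?_ hL0
        have : H (c + N) ≤ H (c + Q) := hH (by gcongr)
        rw [hQ] at this
        linarith
    _ = L := mul_one L

lemma continuous_circle (ψ : AddCircle (1:ℝ) → ℝ) (h : Continuous fun x : ℝ => ψ (x : AddCircle (1:ℝ))) :
    Continuous ψ :=
  (isQuotientMap_quotient_mk').continuous_iff.2 h

lemma transfer_formula (K : ℕ) (hK : 2 ≤ K) (E : ℝ ≃o ℝ) (hE : ∀ x, E (x + 1) = E x + K)
    (f : AddCircle (1:ℝ) → AddCircle (1:ℝ))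
    (hfF : ∀ x : ℝ, f (x : AddCircle (1:ℝ)) = ((E x : ℝ) : AddCircle (1:ℝ)))
    (φ : AddCircle (1:ℝ) → ℝ) (t : ℝ) :
    transfer f φ (t : AddCircle (1:ℝ)) =
      ∑ m ∈ Finset.range K, φ ((E.symm (t + (m:ℝ)) : ℝ) : AddCircle (1:ℝ)) := by
  obtain ⟨s, hs, -, h⟩ := enum_set E K (by omega) hE t (f ⁻¹' {(t : AddCircle (1:ℝ))}) (by
    intro x
    rw [Set.mem_preimage, Set.mem_singleton_iff, hfF, coe_eq_iff_int])
  rw [← h φ, transfer, hs, finsum_mem_coe_finset]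

lemma symm_shift (K : ℕ) (E : ℝ ≃o ℝ) (hE : ∀ x, E (x + 1) = E x + K) (x : ℝ) (m : ℕ) :
    E.symm (x + K * m) = E.symm x + m := by
  rw [E.symm_apply_eq]
  have := shift_int E K hE m (E.symm x)
  push_cast at this
  rw [this, E.apply_symm_apply]; ring

lemma transfer_iter (K : ℕ) (hK : 2 ≤ K) (E : ℝ ≃o ℝ) (hE : ∀ x, E (x + 1) = E x + K)
    (f : AddCircle (1:ℝ) → AddCircle (1:ℝ))
    (hfF : ∀ x : ℝ, f (x : AddCircle (1:ℝ)) = ((E x : ℝ) : AddCircle (1:ℝ)))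
    (φ : AddCircle (1:ℝ) → ℝ) (n : ℕ) (t : ℝ) :
    (transfer f)^[n] φ (t : AddCircle (1:ℝ)) =
      ∑ m ∈ Finset.range (K ^ n), φ ((E.symm^[n] (t + (m:ℝ)) : ℝ) : AddCircle (1:ℝ)) := by
  induction n generalizing t with
  | zero => simp
  | succ n ih =>
    rw [Function.iterate_succ_apply', transfer_formula K hK E hE f hfF]
    simp_rw [ih]
    rw [pow_succ', ← sum_range_mul']
    refine Finset.sum_congr rfl fun j _ => Finset.sum_congr rfl fun m _ => ?_
    rw [Function.iterate_succ_apply, ← symm_shift K E hE]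
    push_cast
    ring_nf

lemma transfer_iter_cont (K : ℕ) (hK : 2 ≤ K) (E : ℝ ≃o ℝ) (hE : ∀ x, E (x + 1) = E x + K)
    (f : AddCircle (1:ℝ) → AddCircle (1:ℝ))
    (hfF : ∀ x : ℝ, f (x : AddCircle (1:ℝ)) = ((E x : ℝ) : AddCircle (1:ℝ)))
    (φ : AddCircle (1:ℝ) → ℝ) (hφ : Continuous φ) (n : ℕ) :
    Continuous ((transfer f)^[n] φ) := by
  apply continuous_circle
  simp_rw [transfer_iter K hK E hE f hfF φ n]
  have h1 : Continuous (E.symm^[n]) := E.symm.continuous.iterate n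
  refine continuous_finsetSum _ fun m _ => ?_
  exact hφ.comp ((AddCircle.continuous_mk' 1).comp (h1.comp (by fun_prop)))

lemma surj_of_expand (G : ℝ → ℝ) (hc : Continuous G) (h : StrictMono G) (N : ℕ) (hN : 0 < N)
    (hG : ∀ x, G (x + 1) = G x + N) : Function.Surjective G := by
  intro y
  have hN' : (0:ℝ) < N := by exact_mod_cast hN
  obtain ⟨a, ha⟩ := exists_int_lt ((y - G 0) / N)
  obtain ⟨b, hb⟩ := exists_int_gt ((y - G 0) / N)
  have h1 := shift_int G N hG a 0
  have h2 := shift_int G N hG b 0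
  rw [lt_div_iff₀ hN'] at ha
  rw [div_lt_iff₀ hN'] at hb
  have := mem_range_of_exists_le_of_exists_ge hc ⟨0 + (a:ℝ), by rw [h1]; linarith⟩
    ⟨0 + (b:ℝ), by rw [h2]; linarith⟩ (c := y)
  exact this

lemma main_bound (K : ℕ) (hK : 2 ≤ K) (E : ℝ ≃o ℝ) (hE : ∀ x, E (x + 1) = E x + K)
    (hexp : ∀ x y, x < y → y - x < E y - E x)
    (f : AddCircle (1:ℝ) → AddCircle (1:ℝ))
    (hfF : ∀ x : ℝ, f (x : AddCircle (1:ℝ)) = ((E x : ℝ) : AddCircle (1:ℝ)))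
    (μ : Measure (AddCircle (1:ℝ))) [IsProbabilityMeasure μ]
    (hμ : ∀ φ : AddCircle (1:ℝ) → ℝ, Continuous φ → ∫ x, transfer f φ x ∂μ = (K : ℝ) * ∫ x, φ x ∂μ)
    (φ : AddCircle (1:ℝ) → ℝ) (hφ : Continuous φ) (L M : ℝ) (hL0 : 0 ≤ L)
    (hL : ∀ x y : ℝ, |φ (x : AddCircle (1:ℝ)) - φ (y : AddCircle (1:ℝ))| ≤ L * |x - y|)
    (hM : ∀ p, |φ p| ≤ M) (n : ℕ) (hn : 1 ≤ n) :
    ∃ s : Finset (AddCircle (1:ℝ)), FixPts f n = ↑s ∧ s.card = K ^ n - 1 ∧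
      |∑ p ∈ s, φ p - (K:ℝ) ^ n * ∫ x, φ x ∂μ| ≤ 2 * L + M := by
  have hKn : 2 ≤ K ^ n := hK.trans (Nat.le_self_pow (by omega) K)
  set N := K ^ n - 1 with hN
  have hNK : K ^ n = N + 1 := by omega
  have hNKr : (K:ℝ) ^ n = N + 1 := by exact_mod_cast hNK
  -- iterates
  have hGexp : ∀ k : ℕ, 1 ≤ k → ∀ x y, x < y → y - x < E^[k] y - E^[k] x := by
    intro k hk
    induction k, hk using Nat.le_induction with
    | base => simpa using hexp
    | succ k hk ih =>
      intro x y hxy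
      rw [Function.iterate_succ_apply', Function.iterate_succ_apply']
      have h1 := ih x y hxy
      have h2 := hexp (E^[k] x) (E^[k] y) (by linarith)
      linarith
  have hGshift : ∀ k : ℕ, ∀ x, E^[k] (x + 1) = E^[k] x + ((K ^ k : ℕ) : ℝ) := by
    intro k
    induction k with
    | zero => simp
    | succ k ih =>
      intro x
      rw [Function.iterate_succ_apply', Function.iterate_succ_apply', ih]
      have := shift_int E K hE ((K ^ k : ℕ) : ℤ) (E^[k] x)
      push_cast at this ⊢
      rw [this]; ring
  have hGlift : ∀ k : ℕ, ∀ x : ℝ, f^[k] (x : AddCircle (1:ℝ)) = ((E^[k] x : ℝ) : AddCircle (1:ℝ)) := by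
    intro k
    induction k with
    | zero => simp
    | succ k ih =>
      intro x
      rw [Function.iterate_succ_apply', Function.iterate_succ_apply', ih, hfF]
  have hinvl : Function.LeftInverse (E.symm^[n]) (E^[n]) :=
    Function.LeftInverse.iterate (fun x => E.symm_apply_apply x) n
  have hinvr : Function.RightInverse (E.symm^[n]) (E^[n]) :=
    Function.RightInverse.iterate (fun x => E.apply_symm_apply x) n
  -- displacement
  set D : ℝ → ℝ := fun x => E^[n] x - x with hD
  have hDmono : StrictMono D := by
    intro x y hxy
    have := hGexp n hn x y hxy
    simp only [hD]; linarith
  have hDc : Continuous D := (E.continuous.iterate n).sub continuous_id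
  have hDs : ∀ x, D (x + 1) = D x + N := by
    intro x
    simp only [hD]
    rw [hGshift, hNK]; push_cast; ring
  have hDsurj := surj_of_expand D hDc hDmono N (by omega) hDs
  set q := hDmono.orderIsoOfSurjective D hDsurj with hq
  have hqD : ∀ x, q x = D x := fun x => rfl
  obtain ⟨s, hs, hcard, hsum⟩ := enum_set q N (by omega) hDs 0 (FixPts f n) (by
    intro x
    simp only [FixPts, Set.mem_ofPred_eq]
    rw [hGlift, coe_eq_iff_int]
    refine exists_congr fun m => ?_
    rw [hqD]
    simp only [hD]
    constructor <;> intro h <;> linarith)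
  refine ⟨s, hs, hcard, ?_⟩
  rw [hsum φ]
  set H := E.symm^[n] with hH
  have hHmono : Monotone H := E.symm.monotone.iterate n
  have hHs : ∀ x, H (x + (K ^ n : ℕ)) = H x + 1 := by
    intro x
    have h1 := hGshift n (H x)
    rw [hinvr x] at h1
    rw [← h1, hinvl]
  set c := q.symm 0 with hc
  have hqH : ∀ m : ℕ, q.symm (0 + (m:ℝ)) = H (q.symm (0 + (m:ℝ)) + m) := by
    intro m
    have h1 : D (q.symm (0 + (m:ℝ))) = 0 + m := q.apply_symm_apply _
    simp only [hD] at h1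
    have h2 : E^[n] (q.symm (0 + (m:ℝ))) = q.symm (0 + (m:ℝ)) + m := by linarith
    rw [← h2, hinvl]
  have hrange : ∀ m < N, c ≤ q.symm (0 + (m:ℝ)) ∧ q.symm (0 + (m:ℝ)) ≤ c + 1 := by
    intro m hm
    constructor
    · exact q.symm.monotone (by simp)
    · rw [q.symm_apply_le]
      have : q (c + 1) = q c + N := hDs c
      rw [this, hc, q.apply_symm_apply]
      gcongr
  have e1 := gap_estimate (fun x : ℝ => φ (x : AddCircle (1:ℝ))) L hL0 hL H hHmono (K ^ n) hHs c N
    (by omega) (fun m => q.symm (0 + (m:ℝ))) hrange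
  simp only [← hqH] at e1
  have e2 : |∑ m ∈ Finset.range (K ^ n), φ ((H (c + m) : ℝ) : AddCircle (1:ℝ))
      - (K:ℝ) ^ n * ∫ x, φ x ∂μ| ≤ L := by
    have hint : ∀ k : ℕ, ∫ x, (transfer f)^[k] φ x ∂μ = (K:ℝ) ^ k * ∫ x, φ x ∂μ := by
      intro k
      induction k with
      | zero => simp
      | succ k ih =>
        rw [Function.iterate_succ_apply', hμ _ (transfer_iter_cont K hK E hE f hfF φ hφ k), ih]
        ring
    rw [← hint n]
    set S := ∑ m ∈ Finset.range (K ^ n), φ ((H (c + m) : ℝ) : AddCircle (1:ℝ)) with hS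
    have hcont := transfer_iter_cont K hK E hE f hfF φ hφ n
    have hI : Integrable ((transfer f)^[n] φ) μ :=
      hcont.integrable_of_hasCompactSupport (HasCompactSupport.of_compactSpace _)
    have h1 : S - ∫ x, (transfer f)^[n] φ x ∂μ = ∫ x, (S - (transfer f)^[n] φ x) ∂μ := by
      rw [integral_sub (integrable_const _) hI]; simp
    rw [h1]
    have h2 := norm_integral_le_of_norm_le_const (μ := μ) (f := fun x => S - (transfer f)^[n] φ x)
      (C := L) (Filter.Eventually.of_forall fun p => by
        obtain ⟨x, hx, rfl⟩ : p ∈ Set.image ((↑) : ℝ → AddCircle (1:ℝ)) (Set.Ico c (c + 1)) := by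
          rw [AddCircle.coe_image_Ico_eq]; trivial
        rw [transfer_iter K hK E hE f hfF, Real.norm_eq_abs, abs_sub_comm]
        exact gap_estimate (fun x : ℝ => φ (x : AddCircle (1:ℝ))) L hL0 hL H hHmono (K ^ n) hHs c
          (K ^ n) le_rfl (fun _ => x) (fun m _ => ⟨hx.1, hx.2.le⟩))
    simpa using h2
  rw [hNK, Finset.sum_range_succ] at e2
  have e3 := hM ((H (c + N) : ℝ) : AddCircle (1:ℝ))
  rw [abs_le] at *
  constructor <;> linarith [e1.1, e1.2, e2.1, e2.2, e3.1, e3.2]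

lemma Emean_chi (f : AddCircle (1:ℝ) → AddCircle (1:ℝ)) (f' : AddCircle (1:ℝ) → ℝ) (n : ℕ)
    (hn : 1 ≤ n) (s : Finset (AddCircle (1:ℝ))) (hs : FixPts f n = ↑s) :
    Emean f n (chi f f' n) = (s.card : ℝ)⁻¹ * ∑ p ∈ s, Real.log (f' p) := by
  have hbij : Set.BijOn f (FixPts f n) (FixPts f n) := Function.bijOn_ptsOfPeriod f hn
  have hk : ∀ k : ℕ, ∑ p ∈ s, Real.log (f' (f^[k] p)) = ∑ p ∈ s, Real.log (f' p) := by
    intro k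
    have h := finsum_mem_eq_of_bijOn (f := fun p => Real.log (f' (f^[k] p)))
      (g := fun p => Real.log (f' p)) (f^[k]) (hbij.iterate k) (fun _ _ => rfl)
    rwa [hs, finsum_mem_coe_finset, finsum_mem_coe_finset] at h
  have hn' : (n:ℝ) ≠ 0 := by positivity
  unfold Emean chi
  rw [hs, finsum_mem_coe_finset, ← Finset.mul_sum, Finset.sum_comm]
  simp_rw [hk]
  rw [Finset.sum_const, Finset.card_range, nsmul_eq_mul, ← mul_assoc (n:ℝ)⁻¹, inv_mul_cancel₀ hn',
    one_mul]
  simp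

/-- There is `C > 0` with `|E(χ_n) - ∫ h dμ| ≤ C K⁻ⁿ` for all `n ≥ 1`; in particular
`E(χ_n) → ∫ h dμ`. -/
theorem stmt5
    (K : ℕ) (hK : 2 ≤ K)
    (F : ℝ → ℝ) (hF : ContDiff ℝ 2 F)
    (hdeg : ∀ x : ℝ, F (x + 1) = F x + K)
    (lam : ℝ) (hlam : 1 < lam)
    (hexp : ∀ x : ℝ, lam ≤ deriv F x)
    (f : AddCircle (1:ℝ) → AddCircle (1:ℝ))
    (hfF : ∀ x : ℝ, f (x : AddCircle (1:ℝ)) = ((F x : ℝ) : AddCircle (1:ℝ)))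
    (f' : AddCircle (1:ℝ) → ℝ)
    (hf'F : ∀ x : ℝ, f' (x : AddCircle (1:ℝ)) = deriv F x)
    (μ : Measure (AddCircle (1:ℝ))) [IsProbabilityMeasure μ]
    (hinv : ∀ φ : AddCircle (1:ℝ) → ℝ, Continuous φ → ∫ x, φ (f x) ∂μ = ∫ x, φ x ∂μ)
    (hμ : ∀ φ : AddCircle (1:ℝ) → ℝ, Continuous φ → ∫ x, transfer f φ x ∂μ = (K : ℝ) * ∫ x, φ x ∂μ)
    :
    ∃ C : ℝ, 0 < C ∧
      (∀ n : ℕ, 1 ≤ n →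
        |Emean f n (chi f f' n) - ∫ x, Real.log (f' x) ∂μ| ≤ C / (K : ℝ) ^ n) ∧
      Tendsto (fun n : ℕ => Emean f n (chi f f' n)) atTop
        (nhds (∫ x, Real.log (f' x) ∂μ)) := by
  have hd : Differentiable ℝ F := hF.differentiable (by norm_num)
  have hder1 : ContDiff ℝ 1 (deriv F) := by
    have : ContDiff ℝ (1 + 1) F := by simpa [one_add_one_eq_two] using hF
    exact (contDiff_succ_iff_deriv.1 this).2.2
  have hpos : ∀ x, 0 < deriv F x := fun x => by linarith [hexp x]
  have hFmono : StrictMono F := strictMono_of_deriv_pos hpos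
  have hFsurj := surj_of_expand F hF.continuous hFmono K (by omega) hdeg
  set E := hFmono.orderIsoOfSurjective F hFsurj with hEdef
  have hEF : ∀ x, E x = F x := fun _ => rfl
  have hsub : StrictMono fun x => F x - x := by
    apply strictMono_of_deriv_pos
    intro x
    rw [deriv_fun_sub (hd x) differentiableAt_fun_id]
    rw [(hasDerivAt_id' x).deriv]
    linarith [hexp x]
  have hgap : ∀ x y, x < y → y - x < E y - E x := by
    intro x y hxy
    have := hsub hxy
    simp only [hEF] at *
    linarith
  have hperF' : Function.Periodic (deriv F) 1 := by
    intro x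
    have h1 : deriv (fun y => F (y + 1)) x = deriv F (x + 1) := deriv_comp_add_const F 1 x
    rw [← h1]
    have : (fun y => F (y + 1)) = fun y => F y + K := funext hdeg
    rw [this, deriv_add_const]
  set g : ℝ → ℝ := fun x => Real.log (deriv F x) with hg
  have hgC : ContDiff ℝ 1 g := hder1.log fun x => (hpos x).ne'
  have hgper : Function.Periodic g 1 := fun x => by simp only [hg]; rw [hperF' x]
  have hg'per : Function.Periodic (deriv g) 1 := by
    intro x
    rw [← deriv_comp_add_const g 1 x]
    congr 1
    exact funext hgper
  obtain ⟨M, hM⟩ := (hgper.isBounded_of_continuous one_ne_zero hgC.continuous).exists_norm_le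
  obtain ⟨L, hL⟩ :=
    (hg'per.isBounded_of_continuous one_ne_zero hgC.continuous_deriv_one).exists_norm_le
  have hM' : ∀ x, |g x| ≤ M := fun x => hM _ ⟨x, rfl⟩
  have hL' : ∀ x, ‖deriv g x‖ ≤ L := fun x => hL _ ⟨x, rfl⟩
  have hL0 : 0 ≤ L := (norm_nonneg _).trans (hL' 0)
  have hM0 : 0 ≤ M := (abs_nonneg _).trans (hM' 0)
  set φ : AddCircle (1:ℝ) → ℝ := fun p => Real.log (f' p) with hφdef
  have hφg : ∀ x : ℝ, φ (x : AddCircle (1:ℝ)) = g x := fun x => by simp only [hφdef, hg, hf'F]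
  have hφc : Continuous φ := by
    apply continuous_circle
    simp_rw [hφg]
    exact hgC.continuous
  have hφM : ∀ p, |φ p| ≤ M := by
    intro p
    induction p using QuotientAddGroup.induction_on with
    | H x => exact (congrArg abs (hφg x)).trans_le (hM' x)
  have hφL : ∀ x y : ℝ, |φ (x : AddCircle (1:ℝ)) - φ (y : AddCircle (1:ℝ))| ≤ L * |x - y| := by
    intro x y
    rw [hφg, hφg]
    exact convex_univ.norm_image_sub_le_of_norm_deriv_le
      (fun z _ => (hgC.differentiable one_ne_zero) z) (fun z _ => hL' z) (Set.mem_univ y)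
      (Set.mem_univ x)
  have hI : |∫ x, φ x ∂μ| ≤ M := by
    have := norm_integral_le_of_norm_le_const (μ := μ) (f := φ) (C := M)
      (Filter.Eventually.of_forall hφM)
    simpa using this
  have hbound : ∀ n : ℕ, 1 ≤ n →
      |Emean f n (chi f f' n) - ∫ x, φ x ∂μ| ≤ (4 * L + 4 * M + 1) / (K : ℝ) ^ n := by
    intro n hn
    obtain ⟨s, hs, hcard, hb⟩ := main_bound K hK E hdeg hgap f hfF μ hμ φ hφc L M hL0 hφL hφM n hn
    rw [Emean_chi f f' n hn s hs]
    have hKn : 2 ≤ K ^ n := hK.trans (Nat.le_self_pow (by omega) K)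
    have hKr : (2:ℝ) ≤ (K:ℝ) ^ n := by exact_mod_cast hKn
    have hcr : (s.card : ℝ) = (K:ℝ) ^ n - 1 := by
      rw [hcard, Nat.cast_sub (by omega)]; push_cast; ring
    rw [hcr]
    set A := ∑ p ∈ s, Real.log (f' p) with hA
    change |A - (K:ℝ) ^ n * ∫ x, φ x ∂μ| ≤ _ at hb
    set I := ∫ x, φ x ∂μ with hIdef
    set Q := (K:ℝ) ^ n with hQ
    have hQ1 : 0 < Q - 1 := by linarith
    have h1 : (Q - 1)⁻¹ * A - I = (A - Q * I + I) / (Q - 1) := by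
      field_simp
      ring
    rw [h1, abs_div, abs_of_pos hQ1, div_le_div_iff₀ hQ1 (by linarith)]
    have h2 : |A - Q * I + I| ≤ 2 * L + 2 * M := (abs_add_le _ _).trans (by linarith)
    have h3 : |A - Q * I + I| * Q ≤ (2 * L + 2 * M) * Q :=
      mul_le_mul_of_nonneg_right h2 (by linarith)
    nlinarith [mul_nonneg (add_nonneg hL0 hM0) (by linarith : (0:ℝ) ≤ Q - 2)]
  refine ⟨4 * L + 4 * M + 1, by positivity, hbound, ?_⟩
  rw [tendsto_iff_dist_tendsto_zero]
  have hlim : Tendsto (fun n : ℕ => (4 * L + 4 * M + 1) / (K : ℝ) ^ n) atTop (nhds 0) := by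
    refine Tendsto.div_atTop tendsto_const_nhds (tendsto_pow_atTop_atTop_of_one_lt ?_)
    exact_mod_cast hK
  refine squeeze_zero' (Filter.Eventually.of_forall fun n => dist_nonneg) ?_ hlim
  filter_upwards [eventually_ge_atTop 1] with n hn
  exact hbound n hn
end
end

section
/- There exists a constant C > 0 such that for every point z ∈ ℝ/ℤ and every integer n ≥ 1, |Var(χ_n) − (Kⁿ − 1)⁻¹·n⁻¹·ℒⁿ(ĥ² + 2·∑_{j=1}^{n-1} ĥ·(ĥ∘f^j))(z)| ≤ C·n⁻². -/
open MeasureTheory Filter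

noncomputable section

/-- Variance of `χ_n` with respect to the uniform probability measure on `FixPts f n`. -/
def VarChi (f : AddCircle (1:ℝ) → AddCircle (1:ℝ)) (f' : AddCircle (1:ℝ) → ℝ) (n : ℕ) : ℝ :=
  Emean f n (fun p => (chi f f' n p - Emean f n (chi f f' n)) ^ 2)

structure ExpMap (F : ℝ → ℝ) (K : ℕ) (lam : ℝ) : Prop where
  cont : Continuous F
  deg : ∀ x, F (x + 1) = F x + K
  exp : ∀ x y, x ≤ y → lam * (y - x) ≤ F y - F x

namespace ExpMap

variable {F : ℝ → ℝ} {K : ℕ} {lam : ℝ}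

lemma inj (h : ExpMap F K lam) (hl : 0 < lam) : Function.Injective F := by
  have : StrictMono F := by
    intro x y hxy
    have := h.exp x y hxy.le
    have h2 : 0 < lam * (y - x) := mul_pos hl (by linarith)
    linarith
  exact this.injective

lemma surj (h : ExpMap F K lam) (hl : 0 < lam) : Function.Surjective F := by
  refine h.cont.surjective ?_ ?_
  · refine tendsto_atTop_mono' atTop (f₁ := fun x => lam * x + F 0) ?_ ?_
    · filter_upwards [eventually_ge_atTop 0] with x hx
      have := h.exp 0 x hx
      simp only [sub_zero] at this
      linarith
    · exact tendsto_atTop_add_const_right _ _ (tendsto_id.const_mul_atTop hl)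
  · refine tendsto_atBot_mono' atBot (f₁ := fun x => lam * x + F 0) ?_ ?_
    · filter_upwards [eventually_le_atBot 0] with x hx
      have := h.exp x 0 hx
      simp only [zero_sub] at this
      linarith
    · exact tendsto_atBot_add_const_right _ _ (tendsto_id.const_mul_atBot hl)

lemma expand (h : ExpMap F K lam) (x y : ℝ) : lam * |x - y| ≤ |F x - F y| := by
  rcases le_total x y with hxy | hxy
  · have := h.exp x y hxy
    rw [abs_sub_comm, abs_of_nonneg (by linarith : 0 ≤ y - x), abs_sub_comm]
    exact this.trans (le_abs_self _)
  · have := h.exp y x hxy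
    rw [abs_of_nonneg (by linarith : 0 ≤ x - y)]
    exact this.trans (le_abs_self _)

lemma degInt (h : ExpMap F K lam) (x : ℝ) (m : ℤ) : F (x + m) = F x + K * m := by
  induction m using Int.induction_on with
  | zero => simp
  | succ i ih => 
    have := h.deg (x + i)
    push_cast at *
    rw [← add_assoc, this, ih]; ring
  | pred i ih =>
    have := h.deg (x + (-i - 1))
    push_cast at *
    rw [show x + (-(i:ℝ) - 1) + 1 = x + -i by ring, ih] at this
    linarith

lemma iter (h : ExpMap F K lam) (hl : 0 ≤ lam) (n : ℕ) : ExpMap F^[n] (K ^ n) (lam ^ n) := by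
  induction n with
  | zero => exact ⟨continuous_id, by simp, by simp⟩
  | succ n ih =>
    refine ⟨h.cont.iterate _, ?_, ?_⟩
    · intro x
      rw [Function.iterate_succ_apply', ih.deg, Function.iterate_succ_apply']
      have := h.degInt (F^[n] x) (K ^ n : ℕ)
      push_cast at *
      rw [this]; ring
    · intro x y hxy
      rw [Function.iterate_succ_apply', Function.iterate_succ_apply']
      have h1 := ih.exp x y hxy
      have h0 : 0 ≤ lam ^ n * (y - x) := mul_nonneg (pow_nonneg hl n) (by linarith)
      have h2 := h.exp (F^[n] x) (F^[n] y) (by linarith)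
      have h3 := mul_le_mul_of_nonneg_left h1 hl
      calc _ = lam * (lam ^ n * (y - x)) := by ring
        _ ≤ _ := h3.trans h2

lemma sub_id (h : ExpMap F K lam) (hK : 1 ≤ K) : ExpMap (fun x => F x - x) (K - 1) (lam - 1) := by
  refine ⟨h.cont.sub continuous_id, ?_, ?_⟩
  · intro x
    rw [h.deg]; push_cast [hK]; ring
  · intro x y hxy
    have := h.exp x y hxy
    linarith

/-- The inverse of the lift. -/
lemma exists_inv (h : ExpMap F K lam) (hl : 0 < lam) :
    ∃ G : ℝ → ℝ, (∀ x, F (G x) = x) ∧ (∀ x, G (F x) = x) ∧ Continuous G ∧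
      ∀ x y, |G x - G y| ≤ lam⁻¹ * |x - y| := by
  obtain ⟨G, hG⟩ := (h.surj hl).hasRightInverse
  have hb : ∀ x y, |G x - G y| ≤ lam⁻¹ * |x - y| := by
    intro x y
    have := h.expand (G x) (G y)
    rw [hG, hG] at this
    rw [inv_mul_eq_div, le_div_iff₀ hl]; linarith
  refine ⟨G, hG, fun x => h.inj hl (hG _), ?_, hb⟩
  have : LipschitzWith (Real.toNNReal lam⁻¹) G := by
    refine LipschitzWith.of_dist_le_mul fun x y => ?_
    rw [Real.dist_eq, Real.dist_eq, Real.coe_toNNReal _ (by positivity)]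
    exact hb x y
  exact this.continuous

lemma coe_eq_iff (x y : ℝ) : ((x : AddCircle (1:ℝ)) = y) ↔ ∃ m : ℤ, y = x + m := by
  rw [eq_comm, ← sub_eq_zero, ← AddCircle.coe_sub, AddCircle.coe_eq_zero_iff]
  constructor
  · rintro ⟨m, hm⟩
    refine ⟨m, ?_⟩
    simp at hm; linarith
  · rintro ⟨m, hm⟩
    refine ⟨m, ?_⟩
    simp [hm]

lemma bijOn (h : ExpMap F K lam) (hl : 0 < lam) (hK : 0 < K) {G : ℝ → ℝ}
    (hG : ∀ x, F (G x) = x) {f : AddCircle (1:ℝ) → AddCircle (1:ℝ)}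
    (hf : ∀ x : ℝ, f (x : AddCircle (1:ℝ)) = ((F x : ℝ) : AddCircle (1:ℝ))) (x : ℝ) :
    Set.BijOn (fun i : ℕ => ((G (x + i) : ℝ) : AddCircle (1:ℝ))) (Finset.range K : Set ℕ)
      (f ⁻¹' {(x : AddCircle (1:ℝ))}) := by
  refine ⟨?_, ?_, ?_⟩
  · intro i hi
    simp only [Set.mem_preimage, Set.mem_singleton_iff, hf, hG]
    rw [eq_comm, coe_eq_iff]
    exact ⟨i, by simp⟩
  · intro i hi j hj hij
    simp only [Finset.coe_range, Set.mem_Iio] at hi hj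
    simp only [coe_eq_iff] at hij
    obtain ⟨m, hm⟩ := hij
    have := h.degInt (G (x + i)) m
    rw [← hm, hG, hG] at this
    have h2 : (j : ℤ) = i + K * m := by
      have : (j : ℝ) = i + K * m := by linarith
      exact_mod_cast this
    have h3 : (j : ℤ) % K = i % K := by rw [h2]; simp
    have h4 : j % K = i % K := by exact_mod_cast h3
    rw [Nat.mod_eq_of_lt hi, Nat.mod_eq_of_lt hj] at h4
    exact h4.symm
  · intro y hy
    induction y using QuotientAddGroup.induction_on with
    | H y =>
    change f (y : AddCircle (1:ℝ)) = x at hy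
    rw [hf, eq_comm, coe_eq_iff] at hy
    obtain ⟨l, hl'⟩ := hy
    have hK' : (0:ℤ) < K := by exact_mod_cast hK
    have hm := Int.emod_nonneg l hK'.ne'
    have hm2 := Int.emod_lt_of_pos l hK'
    have hm3 := Int.emod_add_mul_ediv l K
    obtain ⟨i, hi⟩ := Int.eq_ofNat_of_zero_le hm
    rw [hi] at hm2 hm3
    refine ⟨i, by simpa using hm2, ?_⟩
    change ((G (x + i) : ℝ) : AddCircle (1:ℝ)) = (y : AddCircle (1:ℝ))
    rw [coe_eq_iff]
    refine ⟨l / K, ?_⟩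
    apply h.inj hl
    rw [h.degInt, hG, hl']
    have : (l : ℝ) = i + K * ((l / K : ℤ) : ℝ) := by exact_mod_cast hm3.symm
    rw [this]; ring

lemma transfer_eq (h : ExpMap F K lam) (hl : 0 < lam) (hK : 0 < K) {G : ℝ → ℝ}
    (hG : ∀ x, F (G x) = x) {f : AddCircle (1:ℝ) → AddCircle (1:ℝ)}
    (hf : ∀ x : ℝ, f (x : AddCircle (1:ℝ)) = ((F x : ℝ) : AddCircle (1:ℝ)))
    (φ : AddCircle (1:ℝ) → ℝ) (x : ℝ) :
    transfer f φ (x : AddCircle (1:ℝ)) =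
      ∑ i ∈ Finset.range K, φ ((G (x + i) : ℝ) : AddCircle (1:ℝ)) := by
  have hb := h.bijOn hl hK hG hf x
  unfold transfer
  rw [← finsum_mem_eq_of_bijOn _ hb (fun i hi => rfl), finsum_mem_coe_finset]

lemma finite_preimage (h : ExpMap F K lam) (hl : 0 < lam) (hK : 0 < K)
    {f : AddCircle (1:ℝ) → AddCircle (1:ℝ)}
    (hf : ∀ x : ℝ, f (x : AddCircle (1:ℝ)) = ((F x : ℝ) : AddCircle (1:ℝ)))
    (x : AddCircle (1:ℝ)) : (f ⁻¹' {x}).Finite := by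
  obtain ⟨G, hG, -⟩ := h.exists_inv hl
  induction x using QuotientAddGroup.induction_on with
  | H x =>
  have := (h.bijOn hl hK hG hf x).image_eq
  change (f ⁻¹' {(x : AddCircle (1:ℝ))}).Finite
  rw [← this]
  exact (Finset.finite_toSet _).image _

lemma iter_lift {f : AddCircle (1:ℝ) → AddCircle (1:ℝ)}
    (hf : ∀ x : ℝ, f (x : AddCircle (1:ℝ)) = ((F x : ℝ) : AddCircle (1:ℝ))) (n : ℕ) (x : ℝ) :
    f^[n] (x : AddCircle (1:ℝ)) = ((F^[n] x : ℝ) : AddCircle (1:ℝ)) := by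
  induction n with
  | zero => rfl
  | succ n ih => rw [Function.iterate_succ_apply', Function.iterate_succ_apply', ih, hf]

lemma transfer_iter (h : ExpMap F K lam) (hl : 0 < lam) (hK : 0 < K)
    {f : AddCircle (1:ℝ) → AddCircle (1:ℝ)}
    (hf : ∀ x : ℝ, f (x : AddCircle (1:ℝ)) = ((F x : ℝ) : AddCircle (1:ℝ)))
    (φ : AddCircle (1:ℝ) → ℝ) (n : ℕ) : (transfer f)^[n] φ = transfer f^[n] φ := by
  induction n with
  | zero =>
    funext x
    simp [transfer]
  | succ n ih =>
    rw [Function.iterate_succ_apply', ih]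
    funext x
    have : f^[n+1] ⁻¹' {x} = ⋃ y ∈ f ⁻¹' {x}, f^[n] ⁻¹' {y} := by
      ext w
      simp only [Set.mem_preimage, Set.mem_singleton_iff, Function.iterate_succ_apply', Set.mem_iUnion,
        exists_prop, exists_eq_right']
    unfold transfer
    rw [this, finsum_mem_biUnion]
    · intro a _ b _ hab
      exact Disjoint.preimage _ (by simpa using hab)
    · exact h.finite_preimage hl hK hf x
    · intro y _
      exact (h.iter hl.le n).finite_preimage (by positivity) (by positivity) (iter_lift hf n) y

/-- pull-out property -/
lemma transfer_mul_comp {f : AddCircle (1:ℝ) → AddCircle (1:ℝ)}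
    (φ ψ : AddCircle (1:ℝ) → ℝ) (x : AddCircle (1:ℝ)) :
    transfer f (fun y => φ y * ψ (f y)) x = transfer f φ x * ψ x := by
  unfold transfer
  rw [finsum_mem_mul]
  refine finsum_mem_congr rfl fun y hy => ?_
  rw [show f y = x from hy]

lemma transfer_abs_le (h : ExpMap F K lam) (hl : 0 < lam) (hK : 0 < K)
    {f : AddCircle (1:ℝ) → AddCircle (1:ℝ)}
    (hf : ∀ x : ℝ, f (x : AddCircle (1:ℝ)) = ((F x : ℝ) : AddCircle (1:ℝ)))
    (φ : AddCircle (1:ℝ) → ℝ) (B : ℝ) (hB : ∀ x, |φ x| ≤ B) (x : AddCircle (1:ℝ)) :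
    |transfer f φ x| ≤ K * B := by
  obtain ⟨G, hG, -⟩ := h.exists_inv hl
  induction x using QuotientAddGroup.induction_on with
  | H x =>
  change |transfer f φ (x : AddCircle (1:ℝ))| ≤ K * B
  rw [h.transfer_eq hl hK hG hf]
  refine (Finset.abs_sum_le_sum_abs _ _).trans ?_
  refine (Finset.sum_le_card_nsmul _ _ B fun i _ => hB _).trans ?_
  simp

lemma continuous_transfer (h : ExpMap F K lam) (hl : 0 < lam) (hK : 0 < K)
    {f : AddCircle (1:ℝ) → AddCircle (1:ℝ)}
    (hf : ∀ x : ℝ, f (x : AddCircle (1:ℝ)) = ((F x : ℝ) : AddCircle (1:ℝ)))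
    (φ : AddCircle (1:ℝ) → ℝ) (hφ : Continuous φ) : Continuous (transfer f φ) := by
  obtain ⟨G, hG, -, hGc, -⟩ := h.exists_inv hl
  refine (QuotientAddGroup.isQuotientMap_mk (N := AddSubgroup.zmultiples (1:ℝ))).continuous_iff.2 ?_
  have : (transfer f φ ∘ (QuotientAddGroup.mk : ℝ → AddCircle (1:ℝ))) = 
      fun x : ℝ => ∑ i ∈ Finset.range K, φ ((G (x + i) : ℝ) : AddCircle (1:ℝ)) := by
    funext x
    exact h.transfer_eq hl hK hG hf φ x
  rw [this]
  refine continuous_finsetSum _ fun i _ => hφ.comp ?_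
  exact (AddCircle.continuous_mk' 1).comp (hGc.comp (by fun_prop))

lemma exists_rep (a : ℝ) (x : AddCircle (1:ℝ)) : ∃ y : ℝ, a ≤ y ∧ y < a + 1 ∧ (y : AddCircle (1:ℝ)) = x := by
  induction x using QuotientAddGroup.induction_on with
  | H x =>
  refine ⟨x - ⌊x - a⌋, ?_, ?_, ?_⟩
  · linarith [Int.floor_le (x - a)]
  · linarith [Int.lt_floor_add_one (x - a)]
  · change _ = (x : AddCircle (1:ℝ))
    rw [coe_eq_iff]
    exact ⟨⌊x - a⌋, by ring⟩

lemma transfer_osc (h : ExpMap F K lam) (hl : 0 < lam) (hK : 0 < K)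
    {f : AddCircle (1:ℝ) → AddCircle (1:ℝ)}
    (hf : ∀ x : ℝ, f (x : AddCircle (1:ℝ)) = ((F x : ℝ) : AddCircle (1:ℝ)))
    (φ : AddCircle (1:ℝ) → ℝ) (L : ℝ) (hL0 : 0 ≤ L)
    (hL : ∀ x y : ℝ, |φ (x : AddCircle (1:ℝ)) - φ (y : AddCircle (1:ℝ))| ≤ L * |x - y|)
    (x y : AddCircle (1:ℝ)) :
    |transfer f φ x - transfer f φ y| ≤ K * (L * lam⁻¹) := by
  obtain ⟨G, hG, -, -, hGb⟩ := h.exists_inv hl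
  obtain ⟨x, hx0, hx1, rfl⟩ := exists_rep 0 x
  obtain ⟨y, hy0, hy1, rfl⟩ := exists_rep 0 y
  rw [h.transfer_eq hl hK hG hf, h.transfer_eq hl hK hG hf, ← Finset.sum_sub_distrib]
  refine (Finset.abs_sum_le_sum_abs _ _).trans ?_
  refine (Finset.sum_le_card_nsmul _ _ (L * lam⁻¹) fun i _ => ?_).trans (by simp)
  refine (hL _ _).trans (mul_le_mul_of_nonneg_left ?_ hL0)
  refine (hGb _ _).trans ?_
  have : |x + i - (y + i)| ≤ 1 := by rw [abs_le]; constructor <;> linarith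
  have h2 : 0 ≤ lam⁻¹ := by positivity
  nlinarith

/-- Fixed points, and comparison with the preimages of a point. -/
lemma fix_bijOn (h : ExpMap F K lam) (hl : 1 < lam) (hK : 2 ≤ K)
    {f : AddCircle (1:ℝ) → AddCircle (1:ℝ)}
    (hf : ∀ x : ℝ, f (x : AddCircle (1:ℝ)) = ((F x : ℝ) : AddCircle (1:ℝ))) :
    ∃ q : ℕ → ℝ, (∀ i, F (q i) = q i + i) ∧ (∀ i < K, q 0 ≤ q i ∧ q i ≤ q 0 + 1) ∧
     Set.BijOn (fun i : ℕ => (q i : AddCircle (1:ℝ))) (Finset.range (K - 1) : Set ℕ)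
      {p | f p = p} := by
  have hD := h.sub_id (by omega)
  have hl' : 0 < lam - 1 := by linarith
  obtain ⟨Q, hQ, hQ', -, hQb⟩ := hD.exists_inv hl'
  have hmono : ∀ a b, Q a ≤ Q b ↔ a ≤ b := by
    have hs : StrictMono (fun x => F x - x) := by
      intro x y hxy
      have := hD.exp x y hxy.le
      have h2 : 0 < (lam - 1) * (y - x) := mul_pos hl' (by linarith)
      dsimp only at *
      linarith
    intro a b
    rw [← hs.le_iff_le, hQ, hQ]
  refine ⟨fun i => Q i, ?_, ?_, ?_⟩
  · intro i
    have := hQ i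
    linarith
  · intro i hi
    refine ⟨(hmono _ _).2 (by simp), ?_⟩
    have : Q ((0:ℕ):ℝ) + 1 = Q ((K - 1 : ℕ) : ℝ) := by
      apply hD.inj hl'
      refine (hD.deg _).trans ?_
      dsimp only
      rw [hQ, hQ]; simp
    rw [this, hmono]
    exact_mod_cast (by omega : i ≤ K - 1)
  · have := hD.bijOn (f := fun p => f p - p) hl' (by omega) hQ (fun x => by
      rw [hf, ← AddCircle.coe_sub]) 0
    have e : (fun p => f p - p) ⁻¹' {((0:ℝ) : AddCircle (1:ℝ))} = {p | f p = p} := by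
      ext p
      simp [sub_eq_zero]
    rw [e] at this
    simpa using this

end ExpMap

namespace ExpMap

variable {F : ℝ → ℝ} {K : ℕ} {lam : ℝ}

lemma card_fix (h : ExpMap F K lam) (hl : 1 < lam) (hK : 2 ≤ K)
    {f : AddCircle (1:ℝ) → AddCircle (1:ℝ)}
    (hf : ∀ x : ℝ, f (x : AddCircle (1:ℝ)) = ((F x : ℝ) : AddCircle (1:ℝ))) :
    {p | f p = p}.Finite ∧ (Nat.card {p | f p = p} : ℝ) = K - 1 := by
  obtain ⟨q, -, -, hb⟩ := h.fix_bijOn hl hK hf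
  constructor
  · rw [← hb.image_eq]
    exact (Finset.finite_toSet _).image _
  · have := Nat.card_congr hb.equiv
    rw [← this]
    simp
    push_cast [show 1 ≤ K by omega]
    ring

lemma fix_compare (h : ExpMap F K lam) (hl : 1 < lam) (hK : 2 ≤ K)
    {f : AddCircle (1:ℝ) → AddCircle (1:ℝ)}
    (hf : ∀ x : ℝ, f (x : AddCircle (1:ℝ)) = ((F x : ℝ) : AddCircle (1:ℝ)))
    (φ : AddCircle (1:ℝ) → ℝ) (B ε : ℝ) (hB : ∀ x, |φ x| ≤ B) (hε0 : 0 ≤ ε)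
    (hε : ∀ a b : ℝ, |F a - F b| ≤ 1 → |φ (a : AddCircle (1:ℝ)) - φ (b : AddCircle (1:ℝ))| ≤ ε)
    (z : AddCircle (1:ℝ)) :
    |(∑ᶠ p ∈ {p | f p = p}, φ p) - transfer f φ z| ≤ K * ε + B := by
  obtain ⟨q, hq, hq1, hb⟩ := h.fix_bijOn hl hK hf
  have hl' : 0 < lam := by linarith
  obtain ⟨G, hG, -⟩ := h.exists_inv hl'
  obtain ⟨z, hz0, hz1, rfl⟩ := exists_rep (q 0) z
  rw [h.transfer_eq hl' (by omega) hG hf]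
  rw [← finsum_mem_eq_of_bijOn _ hb (fun i hi => rfl), finsum_mem_coe_finset]
  obtain ⟨k, rfl⟩ : ∃ k, K = k + 1 := ⟨K - 1, by omega⟩
  rw [Finset.sum_range_succ, Nat.add_sub_cancel, ← sub_sub, ← Finset.sum_sub_distrib]
  refine (abs_sub _ _).trans (add_le_add ?_ (hB _))
  refine (Finset.abs_sum_le_sum_abs _ _).trans ?_
  refine (Finset.sum_le_card_nsmul _ _ ε fun i hi => ?_).trans ?_
  · apply hε
    rw [hq, hG]
    have := hq1 i (by simp at hi; omega)
    rw [abs_le]; constructor <;> linarith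
  · simp; nlinarith

lemma decay (h : ExpMap F K lam) (hl : 1 < lam) (hK : 2 ≤ K)
    {f : AddCircle (1:ℝ) → AddCircle (1:ℝ)}
    (hf : ∀ x : ℝ, f (x : AddCircle (1:ℝ)) = ((F x : ℝ) : AddCircle (1:ℝ)))
    (μ : Measure (AddCircle (1:ℝ))) [IsProbabilityMeasure μ]
    (hμ : ∀ φ : AddCircle (1:ℝ) → ℝ, Continuous φ → ∫ x, transfer f φ x ∂μ = (K : ℝ) * ∫ x, φ x ∂μ)
    (g : AddCircle (1:ℝ) → ℝ) (hg : Continuous g) (hg0 : ∫ x, g x ∂μ = 0)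
    (L : ℝ) (hL0 : 0 ≤ L)
    (hL : ∀ x y : ℝ, |g (x : AddCircle (1:ℝ)) - g (y : AddCircle (1:ℝ))| ≤ L * |x - y|)
    (j : ℕ) (x : AddCircle (1:ℝ)) :
    |transfer f^[j] g x| ≤ K ^ j * (L * (lam ^ j)⁻¹) := by
  have hl' : 0 < lam := by linarith
  have hK' : 0 < K := by omega
  have hc : Continuous (transfer f^[j] g) ∧ ∫ x, transfer f^[j] g x ∂μ = 0 := by
    rw [← h.transfer_iter hl' hK' hf]
    induction j with
    | zero => exact ⟨hg, hg0⟩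
    | succ n ih =>
      rw [Function.iterate_succ_apply']
      refine ⟨h.continuous_transfer hl' hK' hf _ ih.1, ?_⟩
      rw [hμ _ ih.1, ih.2, mul_zero]
  have hi : Integrable (transfer f^[j] g) μ := 
    hc.1.integrable_of_hasCompactSupport (HasCompactSupport.of_compactSpace _)
  have e : transfer f^[j] g x = ∫ y, (transfer f^[j] g x - transfer f^[j] g y) ∂μ := by
    rw [integral_sub (integrable_const _) hi, hc.2]; simp
  rw [e]
  have := norm_integral_le_of_norm_le_const (μ := μ) 
    (f := fun y => (transfer f^[j] g x - transfer f^[j] g y)) (C := K ^ j * (L * (lam ^ j)⁻¹)) 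
    (Eventually.of_forall fun y => by
      have := (h.iter hl'.le j).transfer_osc (by positivity) (by positivity) (iter_lift hf j) g L hL0 hL x y
      simpa using this)
  simpa using this

/-- the correlation product -/
def corr (f : AddCircle (1:ℝ) → AddCircle (1:ℝ)) (g : AddCircle (1:ℝ) → ℝ) (d : ℕ) :
    AddCircle (1:ℝ) → ℝ := fun x => g x * g (f^[d] x)

lemma corr_bounds (h : ExpMap F K lam) (hl : 1 < lam) (hl2 : lam ≤ 2) (hK : 2 ≤ K)
    {f : AddCircle (1:ℝ) → AddCircle (1:ℝ)}
    (hf : ∀ x : ℝ, f (x : AddCircle (1:ℝ)) = ((F x : ℝ) : AddCircle (1:ℝ)))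
    (μ : Measure (AddCircle (1:ℝ))) [IsProbabilityMeasure μ]
    (hμ : ∀ φ : AddCircle (1:ℝ) → ℝ, Continuous φ → ∫ x, transfer f φ x ∂μ = (K : ℝ) * ∫ x, φ x ∂μ)
    (g : AddCircle (1:ℝ) → ℝ) (hg : Continuous g) (hg0 : ∫ x, g x ∂μ = 0)
    (L : ℝ) (hL0 : 0 ≤ L)
    (hL : ∀ x y : ℝ, |g (x : AddCircle (1:ℝ)) - g (y : AddCircle (1:ℝ))| ≤ L * |x - y|)
    (M : ℝ) (hM0 : 0 ≤ M) (hM : ∀ x, |g x| ≤ M) :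
    ∃ C0 : ℝ, 0 ≤ C0 ∧ ∀ n, 1 ≤ n → ∀ z, 
      (∀ d, d ≤ n → |((K:ℝ) ^ n - 1)⁻¹ * transfer f^[n] (corr f g d) z| ≤ C0 * (lam ^ d)⁻¹) ∧
      (∀ d, d ≤ n → |Emean f n (corr f g d) - ((K:ℝ) ^ n - 1)⁻¹ * transfer f^[n] (corr f g d) z|
         ≤ C0 * (lam ^ (n - d))⁻¹) ∧
      |Emean f n g| ≤ C0 * (lam ^ n)⁻¹ := by
  have hl' : 0 < lam := by linarith
  have hK' : 0 < K := by omega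
  refine ⟨4 * M * L + 2 * M * M + 4 * L + 2 * M, by positivity, fun n hn z => ?_⟩
  have hN2 : 2 ≤ K ^ n := hK.trans (Nat.le_self_pow (by omega) K)
  have hN2' : (2:ℝ) ≤ (K:ℝ) ^ n := by exact_mod_cast hN2
  have hlamN : lam ^ n ≤ (K:ℝ) ^ n := 
    pow_le_pow_left₀ hl'.le (hl2.trans (by exact_mod_cast hK)) n
  have hnl : 1 < lam ^ n := one_lt_pow₀ hl (by omega)
  set N : ℝ := (K:ℝ) ^ n with hN
  have hinvN : (N - 1)⁻¹ ≤ 2 * N⁻¹ := by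
    rw [← div_eq_mul_inv, inv_eq_one_div, div_le_div_iff₀ (by linarith) (by linarith)]; linarith
  have hinvN0 : 0 ≤ (N - 1)⁻¹ := inv_nonneg.2 (by linarith)
  -- scaling lemma
  have scale : ∀ a e b c: ℝ, 0 ≤ e → 0 ≤ b → |a| ≤ N * e + b → b * (lam ^ n)⁻¹ ≤ c → 
      |(N - 1)⁻¹ * a| ≤ 2 * e + 2 * c := by
    intro a e b c he hb ha hc
    rw [abs_mul, abs_of_nonneg hinvN0]
    have h1 : (N - 1)⁻¹ * |a| ≤ (2 * N⁻¹) * (N * e + b) := by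
      gcongr
    have h2 : (2 * N⁻¹) * (N * e + b) = 2 * e + 2 * (b * N⁻¹) := by
      field_simp
    have h3 : b * N⁻¹ ≤ b * (lam ^ n)⁻¹ := by gcongr
    linarith
  have hn' := h.iter hl'.le n
  have hfn := iter_lift hf n
  have hcard := hn'.card_fix hnl hN2 hfn
  have hcomp := fun φ B ε h1 h2 h3 => hn'.fix_compare hnl hN2 hfn φ B ε h1 h2 h3 z
  have hEm : ∀ ψ, Emean f n ψ = (N - 1)⁻¹ * ∑ᶠ p ∈ {p | f^[n] p = p}, ψ p := by
    intro ψ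
    unfold Emean
    have : (Nat.card (FixPts f n) : ℝ) = N - 1 := by
      have := hcard.2
      push_cast at this
      exact this
    rw [this]; rfl
  have hcM : ∀ d x, |corr f g d x| ≤ M * M := by
    intro d x
    unfold corr
    rw [abs_mul]
    exact mul_le_mul (hM _) (hM _) (abs_nonneg _) hM0
  have hdec := h.decay hl hK hf μ hμ g hg hg0 L hL0 hL
  have hclose : ∀ a b : ℝ, |F^[n] a - F^[n] b| ≤ 1 → ∀ d ≤ n, 
      |g (f^[d] a) - g (f^[d] b)| ≤ L * (lam ^ (n - d))⁻¹ := by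
    intro a b hab d hd
    rw [iter_lift hf, iter_lift hf]
    refine (hL _ _).trans (mul_le_mul_of_nonneg_left ?_ hL0)
    have := (h.iter hl'.le (n - d)).expand (F^[d] a) (F^[d] b)
    rw [← Function.iterate_add_apply, ← Function.iterate_add_apply, Nat.sub_add_cancel hd] at this
    rw [inv_eq_one_div, le_div_iff₀ (by positivity)]
    linarith
  refine ⟨?_, ?_, ?_⟩
  · intro d hd
    have hle : |transfer f^[n] (corr f g d) z| ≤ N * (M * L * (lam ^ d)⁻¹) := by
      have e1 : transfer f^[n] (corr f g d) = transfer f^[n - d] (fun x => transfer f^[d] g x * g x) := by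
        rw [← h.transfer_iter hl' hK' hf, ← h.transfer_iter hl' hK' hf, 
          show n = (n - d) + d by omega, Function.iterate_add_apply, Nat.add_sub_cancel]
        congr 1
        rw [h.transfer_iter hl' hK' hf]
        funext x
        exact transfer_mul_comp g g x
      rw [e1]
      have := (h.iter hl'.le (n - d)).transfer_abs_le (by positivity) (by positivity) 
        (iter_lift hf (n - d)) (fun x => transfer f^[d] g x * g x) 
        ((K ^ d * (L * (lam ^ d)⁻¹)) * M) (fun x => by
          rw [abs_mul]
          exact mul_le_mul (hdec d x) (hM x) (abs_nonneg _) (by positivity)) z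
      refine this.trans (le_of_eq ?_)
      have : N = (K:ℝ) ^ (n - d) * K ^ d := by rw [← pow_add, Nat.sub_add_cancel hd]
      rw [this]; push_cast; ring
    have := scale _ (M * L * (lam ^ d)⁻¹) 0 0 (by positivity) le_rfl (by simpa using hle) (by simp)
    refine this.trans ?_
    have hp : 0 ≤ (lam ^ d)⁻¹ := by positivity
    have : 0 ≤ (2 * M * L + 2 * M * M + 4 * L + 2 * M) * (lam ^ d)⁻¹ := by positivity
    linarith
  · intro d hd
    rw [hEm, ← mul_sub]
    have hmon : (lam ^ n)⁻¹ ≤ (lam ^ (n - d))⁻¹ := by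
      have : lam ^ (n - d) ≤ lam ^ n := pow_le_pow_right₀ hl.le (by omega)
      gcongr
    have hp : 0 ≤ (lam ^ (n - d))⁻¹ := by positivity
    have hle := hcomp (corr f g d) (M * M) (2 * M * L * (lam ^ (n - d))⁻¹) (hcM d) (by positivity) (by
      intro a b hab
      have h1 := hclose a b hab d hd
      have h0 := hclose a b hab 0 (by omega)
      simp only [Function.iterate_zero, id, Nat.sub_zero] at h0
      have h0' := h0.trans (mul_le_mul_of_nonneg_left hmon hL0)
      unfold corr
      rw [show g a * g (f^[d] a) - g b * g (f^[d] b) = 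
        g a * (g (f^[d] a) - g (f^[d] b)) + (g a - g b) * g (f^[d] b) by ring]
      refine (abs_add_le _ _).trans ?_
      rw [abs_mul, abs_mul]
      have e1 := mul_le_mul (hM a) h1 (abs_nonneg _) hM0
      have e2 := mul_le_mul h0' (hM (f^[d] b)) (abs_nonneg _) (by positivity)
      linarith)
    push_cast at hle
    have := scale _ _ _ (M * M * (lam ^ (n - d))⁻¹) (by positivity) (by positivity) hle (by gcongr)
    refine this.trans ?_
    have : 0 ≤ (4 * L + 2 * M) * (lam ^ (n - d))⁻¹ := by positivity
    linarith
  · rw [hEm]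
    have hp : 0 ≤ (lam ^ n)⁻¹ := by positivity
    have hle := hcomp g M (L * (lam ^ n)⁻¹) hM (by positivity) (by
      intro a b hab
      have h0 := hclose a b hab 0 (by omega)
      simpa using h0)
    push_cast at hle
    have h2 := hdec n z
    have h3 := abs_add_le ((∑ᶠ p ∈ {p | f^[n] p = p}, g p) - transfer f^[n] g z) (transfer f^[n] g z)
    rw [sub_add_cancel] at h3
    have := scale (∑ᶠ p ∈ {p | f^[n] p = p}, g p) (2 * L * (lam ^ n)⁻¹) M (M * (lam ^ n)⁻¹) 
      (by positivity) hM0 (by linarith) le_rfl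
    refine this.trans ?_
    have : 0 ≤ (4 * M * L + 2 * M * M) * (lam ^ n)⁻¹ := by positivity
    linarith

end ExpMap

namespace ExpMap

lemma Emean_eq {f : AddCircle (1:ℝ) → AddCircle (1:ℝ)} {n : ℕ} (hfin : (FixPts f n).Finite)
    (ψ : AddCircle (1:ℝ) → ℝ) :
    Emean f n ψ = (Nat.card (FixPts f n) : ℝ)⁻¹ * ∑ p ∈ hfin.toFinset, ψ p := by
  unfold Emean
  rw [finsum_mem_eq_finite_toFinset_sum _ hfin]

lemma Emean_comp {f : AddCircle (1:ℝ) → AddCircle (1:ℝ)} {n : ℕ} (hn : 1 ≤ n)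
    (ψ : AddCircle (1:ℝ) → ℝ) (k : ℕ) :
    Emean f n (fun p => ψ (f^[k] p)) = Emean f n ψ := by
  induction k with
  | zero => rfl
  | succ k ih =>
    rw [← ih]
    unfold Emean
    congr 1
    have hb : Set.BijOn f (FixPts f n) (FixPts f n) := Function.bijOn_ptsOfPeriod f hn
    exact finsum_mem_eq_of_bijOn f hb (fun i _ => rfl)

lemma Emean_congr {f : AddCircle (1:ℝ) → AddCircle (1:ℝ)} {n : ℕ} 
    {ψ φ : AddCircle (1:ℝ) → ℝ} (h : ∀ p, f^[n] p = p → ψ p = φ p) :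
    Emean f n ψ = Emean f n φ := by
  unfold Emean
  rw [finsum_mem_congr (s := FixPts f n) rfl (fun p hp => h p hp)]

lemma corr_symm {f : AddCircle (1:ℝ) → AddCircle (1:ℝ)} {n : ℕ} (hn : 1 ≤ n)
    (g : AddCircle (1:ℝ) → ℝ) (d : ℕ) (hd : d ≤ n) :
    Emean f n (corr f g d) = Emean f n (corr f g (n - d)) := by
  rw [← Emean_comp hn (corr f g d) (n - d)]
  refine Emean_congr fun p hp => ?_
  unfold corr
  rw [← Function.iterate_add_apply, Nat.add_sub_cancel' hd, hp, mul_comm]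

lemma var_eq {f : AddCircle (1:ℝ) → AddCircle (1:ℝ)} {n : ℕ} (hn : 1 ≤ n)
    (hfin : (FixPts f n).Finite) (hc : (Nat.card (FixPts f n) : ℝ) ≠ 0)
    (f' : AddCircle (1:ℝ) → ℝ) (m : ℝ) (g : AddCircle (1:ℝ) → ℝ) 
    (hg : ∀ x, g x = Real.log (f' x) - m) :
    VarChi f f' n = (n:ℝ)⁻¹ * ∑ d ∈ Finset.range n, Emean f n (corr f g d) - (Emean f n g) ^ 2 := by
  have hn0 : (n:ℝ) ≠ 0 := by positivity
  set X : AddCircle (1:ℝ) → ℝ := fun p => ∑ k ∈ Finset.range n, g (f^[k] p) with hX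
  have lin_add : ∀ a b : AddCircle (1:ℝ) → ℝ, Emean f n (fun p => a p + b p) = Emean f n a + Emean f n b := by
    intro a b; simp only [Emean_eq hfin, Finset.sum_add_distrib, mul_add]
  have lin_mul : ∀ (r : ℝ) (a : AddCircle (1:ℝ) → ℝ), Emean f n (fun p => r * a p) = r * Emean f n a := by
    intro r a; simp only [Emean_eq hfin, ← Finset.mul_sum]; ring
  have lin_const : ∀ r : ℝ, Emean f n (fun _ => r) = r := by
    intro r
    simp only [Emean_eq hfin, Finset.sum_const, nsmul_eq_mul]
    rw [← Nat.card_eq_card_finite_toFinset hfin]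
    field_simp
  have lin_sum : ∀ a : ℕ → AddCircle (1:ℝ) → ℝ, Emean f n (fun p => ∑ k ∈ Finset.range n, a k p) = 
      ∑ k ∈ Finset.range n, Emean f n (a k) := by
    intro a
    simp only [Emean_eq hfin]
    rw [Finset.sum_comm, Finset.mul_sum]
  have hXinv1 : ∀ p, f^[n] p = p → X (f p) = X p := by
    intro p hp
    have h1 := Finset.sum_range_succ (fun k => g (f^[k] p)) n
    have h2 := Finset.sum_range_succ' (fun k => g (f^[k] p)) n
    rw [h1] at h2
    simp only [hp, Function.iterate_zero, id] at h2
    simp only [hX, ← Function.iterate_succ_apply]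
    linarith
  have hXinv : ∀ k p, f^[n] p = p → X (f^[k] p) = X p := by
    intro k
    induction k with
    | zero => intro p _; rfl
    | succ k ih =>
      intro p hp
      rw [Function.iterate_succ_apply', hXinv1, ih p hp]
      rw [← Function.iterate_add_apply, add_comm, Function.iterate_add_apply, hp]
  have hEX : Emean f n X = n * Emean f n g := by
    rw [hX, lin_sum]
    simp only [Emean_comp hn g, Finset.sum_const, Finset.card_range, nsmul_eq_mul]
  have hEX2 : Emean f n (fun p => X p * X p) = n * ∑ d ∈ Finset.range n, Emean f n (corr f g d) := by
    have e1 : (fun p => X p * X p) = fun p => ∑ k ∈ Finset.range n, g (f^[k] p) * X p := by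
      funext p
      rw [← Finset.sum_mul]
    have e2 : ∀ k, Emean f n (fun p => g (f^[k] p) * X p) = Emean f n (fun p => g p * X p) := by
      intro k
      rw [← Emean_comp hn (fun p => g p * X p) k]
      refine Emean_congr fun p hp => ?_
      rw [hXinv k p hp]
    rw [e1, lin_sum, Finset.sum_congr rfl (fun k _ => e2 k)]
    simp only [Finset.sum_const, Finset.card_range, nsmul_eq_mul]
    congr 1
    rw [← lin_sum]
    congr 1
    funext p
    simp only [corr, hX, Finset.mul_sum]
  have hchi : ∀ p, chi f f' n p = (n:ℝ)⁻¹ * X p + m := by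
    intro p
    simp only [chi, hX, hg, Finset.sum_sub_distrib, Finset.sum_const, Finset.card_range, nsmul_eq_mul]
    field_simp; ring
  have hEchi : Emean f n (chi f f' n) = Emean f n g + m := by
    rw [show chi f f' n = fun p => (n:ℝ)⁻¹ * X p + m from funext hchi, lin_add, lin_mul, lin_const, hEX]
    field_simp
  unfold VarChi
  rw [hEchi]
  set e := Emean f n g
  have : (fun p => (chi f f' n p - (e + m)) ^ 2) = fun p => ((n:ℝ)⁻¹) ^ 2 * (X p * X p) + 
      ((-2 * (n:ℝ)⁻¹ * e) * X p + e ^ 2) := by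
    funext p; rw [hchi]; ring
  rw [this, lin_add, lin_add, lin_mul, lin_mul, lin_const, hEX, hEX2]
  field_simp; ring

lemma bound_seq (ρ : ℝ) (hρ : 1 < ρ) : ∃ C, 0 ≤ C ∧ ∀ n : ℕ, (n:ℝ) ^ 2 * (ρ ^ n)⁻¹ ≤ C := by
  have := tendsto_pow_const_div_const_pow_of_one_lt 2 hρ
  obtain ⟨C, hC⟩ := this.bddAbove_range
  refine ⟨max C 0, le_max_right _ _, fun n => ?_⟩
  exact (hC ⟨n, rfl⟩ : (n:ℝ) ^ 2 / ρ ^ n ≤ C).trans (le_max_left _ _)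

lemma regularity {K : ℕ} {F : ℝ → ℝ} (hF : ContDiff ℝ 2 F)
    (hdeg : ∀ x : ℝ, F (x + 1) = F x + K)
    (lam : ℝ) (hlam : 1 < lam)
    (hexp : ∀ x : ℝ, lam ≤ deriv F x) :
    ∃ L M : ℝ, 0 ≤ L ∧ 0 ≤ M ∧ Continuous (fun x => Real.log (deriv F x)) ∧ 
     (∀ x y, |Real.log (deriv F x) - Real.log (deriv F y)| ≤ L * |x - y|) ∧
     (∀ x, |Real.log (deriv F x)| ≤ M) := by
  set H : ℝ → ℝ := fun x => Real.log (deriv F x) with hH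
  have hd1 : ContDiff ℝ 1 (deriv F) := by
    have := (contDiff_succ_iff_deriv (n := 1) (f := F) (𝕜 := ℝ)).1 (by rw [one_add_one_eq_two]; exact hF)
    exact this.2.2
  have hH1 : ContDiff ℝ 1 H := hd1.log (fun x => by linarith [hexp x])
  have hp : Function.Periodic H 1 := by
    intro x
    have : deriv F (x + 1) = deriv F x := by
      rw [← deriv_comp_add_const]
      rw [show (fun x => F (x + 1)) = fun x => F x + K from funext hdeg]
      simp
    simp only [hH, this]
  have hp' : Function.Periodic (deriv H) 1 := by
    intro x
    rw [← deriv_comp_add_const]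
    rw [show (fun x => H (x + 1)) = H from funext hp]
  have bdd : ∀ u : ℝ → ℝ, Continuous u → Function.Periodic u 1 → ∃ B, 0 ≤ B ∧ ∀ x, |u x| ≤ B := by
    intro u hu hpu
    obtain ⟨B, hB⟩ := (isCompact_Icc (a := (0:ℝ)) (b := 1)).exists_bound_of_continuousOn hu.continuousOn
    refine ⟨B, (norm_nonneg _).trans (hB 0 (by simp)), fun x => ?_⟩
    obtain ⟨y, hy, hxy⟩ := hpu.exists_mem_Ico₀ one_pos x
    rw [hxy]
    exact hB y ⟨hy.1, hy.2.le⟩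
  obtain ⟨M, hM0, hM⟩ := bdd H hH1.continuous hp
  obtain ⟨L, hL0, hL⟩ := bdd (deriv H) (hH1.continuous_deriv le_rfl) hp'
  refine ⟨L, M, hL0, hM0, hH1.continuous, ?_, hM⟩
  intro x y
  have := Convex.norm_image_sub_le_of_norm_deriv_le (f := H) (C := L) (s := Set.univ) (x := y) (y := x) 
    (fun z _ => (hH1.differentiable one_ne_zero).differentiableAt) (fun z _ => hL z) convex_univ trivial trivial
  exact this

end ExpMap

/-- There is `C > 0` such that `Var(χ_n)` differs from
`(Kⁿ-1)⁻¹ n⁻¹ ℒⁿ(ĥ² + 2∑_{j=1}^{n-1} ĥ·(ĥ∘f^j))(z)` by at most `C n⁻²`. -/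
theorem stmt9
    (K : ℕ) (hK : 2 ≤ K)
    (F : ℝ → ℝ) (hF : ContDiff ℝ 2 F)
    (hdeg : ∀ x : ℝ, F (x + 1) = F x + K)
    (lam : ℝ) (hlam : 1 < lam)
    (hexp : ∀ x : ℝ, lam ≤ deriv F x)
    (f : AddCircle (1:ℝ) → AddCircle (1:ℝ))
    (hfF : ∀ x : ℝ, f (x : AddCircle (1:ℝ)) = ((F x : ℝ) : AddCircle (1:ℝ)))
    (f' : AddCircle (1:ℝ) → ℝ)
    (hf'F : ∀ x : ℝ, f' (x : AddCircle (1:ℝ)) = deriv F x)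
    (μ : Measure (AddCircle (1:ℝ))) [IsProbabilityMeasure μ]
    (hinv : ∀ φ : AddCircle (1:ℝ) → ℝ, Continuous φ → ∫ x, φ (f x) ∂μ = ∫ x, φ x ∂μ)
    (hμ : ∀ φ : AddCircle (1:ℝ) → ℝ, Continuous φ → ∫ x, transfer f φ x ∂μ = (K : ℝ) * ∫ x, φ x ∂μ)
    :
    ∃ C : ℝ, 0 < C ∧ ∀ z : AddCircle (1:ℝ), ∀ n : ℕ, 1 ≤ n →
      |VarChi f f' n - ((K : ℝ) ^ n - 1)⁻¹ * (n : ℝ)⁻¹ *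
          (transfer f)^[n]
            (fun x => (Real.log (f' x) - ∫ y, Real.log (f' y) ∂μ) ^ 2 +
              2 * ∑ j ∈ Finset.Ico 1 n,
                (Real.log (f' x) - ∫ y, Real.log (f' y) ∂μ) *
                  (Real.log (f' (f^[j] x)) - ∫ y, Real.log (f' y) ∂μ)) z| ≤
        C / (n : ℝ) ^ 2 := by
  classical
  obtain ⟨L, M, hL0, hM0, hHc, hHL, hHM⟩ := ExpMap.regularity hF hdeg lam hlam hexp
  obtain ⟨l, hl1, hl2, hll⟩ : ∃ l : ℝ, 1 < l ∧ l ≤ 2 ∧ l ≤ lam :=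
    ⟨min lam 2, lt_min hlam one_lt_two, min_le_right _ _, min_le_left _ _⟩
  have hl0 : 0 < l := by linarith
  have hK0 : 0 < K := by omega
  have h : ExpMap F K l := by
    refine ⟨hF.continuous, hdeg, fun x y hxy => ?_⟩
    exact mul_sub_le_image_sub_of_le_deriv (hF.differentiable (by norm_num))
      (fun z => hll.trans (hexp z)) hxy
  set m := ∫ y, Real.log (f' y) ∂μ with hm
  set g : AddCircle (1:ℝ) → ℝ := fun x => Real.log (f' x) - m with hg
  have hlc : Continuous (fun x => Real.log (f' x)) := by
    refine (QuotientAddGroup.isQuotientMap_mk (N := AddSubgroup.zmultiples (1:ℝ))).continuous_iff.2 ?_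
    have : ((fun x => Real.log (f' x)) ∘ (QuotientAddGroup.mk : ℝ → AddCircle (1:ℝ))) =
        fun x : ℝ => Real.log (deriv F x) := by
      funext x
      exact congrArg Real.log (hf'F x)
    rw [this]
    exact hHc
  have hgc : Continuous g := hlc.sub continuous_const
  have hg0 : ∫ x, g x ∂μ = 0 := by
    have hi : Integrable (fun x => Real.log (f' x)) μ :=
      hlc.integrable_of_hasCompactSupport (HasCompactSupport.of_compactSpace _)
    simp only [hg]
    rw [integral_sub hi (integrable_const _)]
    simp [hm]
  have hgL : ∀ x y : ℝ, |g (x : AddCircle (1:ℝ)) - g (y : AddCircle (1:ℝ))| ≤ L * |x - y| := by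
    intro x y
    simp only [hg, hf'F]
    rw [sub_sub_sub_cancel_right]
    exact hHL x y
  have hgM : ∀ x, |g x| ≤ M + |m| := by
    intro x
    obtain ⟨x, -, -, rfl⟩ := ExpMap.exists_rep 0 x
    simp only [hg, hf'F]
    exact (abs_sub _ _).trans (add_le_add (hHM x) le_rfl)
  obtain ⟨C0, hC0, hb⟩ := h.corr_bounds hl1 hl2 hK hfF μ hμ g hgc hg0 L hL0 hgL (M + |m|)
    (by positivity) hgM
  have hρ : 1 < Real.sqrt l := by
    rw [Real.lt_sqrt zero_le_one]; simpa using hl1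
  set ρ := Real.sqrt l with hρd
  have hρl : ∀ k, l ^ k = ρ ^ (2 * k) := by
    intro k
    rw [pow_mul, hρd, Real.sq_sqrt hl0.le]
  obtain ⟨C1, hC1, hs⟩ := ExpMap.bound_seq ρ hρ
  refine ⟨(2 * C0 + C0 ^ 2) * C1 + 1, by positivity, fun z n hn => ?_⟩
  obtain ⟨hA, hcA, hE⟩ := hb n hn z
  have hnl : 1 < l ^ n := one_lt_pow₀ hl1 (by omega)
  have hN2 : 2 ≤ K ^ n := hK.trans (Nat.le_self_pow (by omega) K)
  have hn' := h.iter hl0.le n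
  have hfn := ExpMap.iter_lift hfF n
  have hcard := hn'.card_fix hnl hN2 hfn
  have hcard2 : (Nat.card (FixPts f n) : ℝ) = (K ^ n : ℕ) - 1 := hcard.2
  have hcard0 : (Nat.card (FixPts f n) : ℝ) ≠ 0 := by
    rw [hcard2]
    have : (2:ℝ) ≤ (K ^ n : ℕ) := by exact_mod_cast hN2
    intro h0
    linarith
  rw [ExpMap.var_eq hn hcard.1 hcard0 f' m g (fun x => rfl)]
  rw [h.transfer_iter hl0 hK0 hfF]
  have hT : transfer f^[n] (fun x => (Real.log (f' x) - m) ^ 2 +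
              2 * ∑ j ∈ Finset.Ico 1 n,
                (Real.log (f' x) - m) *
                  (Real.log (f' (f^[j] x)) - m)) z =
      transfer f^[n] (ExpMap.corr f g 0) z +
        2 * ∑ j ∈ Finset.Ico 1 n, transfer f^[n] (ExpMap.corr f g j) z := by
    obtain ⟨G, hG, -⟩ := hn'.exists_inv (by positivity)
    obtain ⟨z, -, -, rfl⟩ := ExpMap.exists_rep 0 z
    simp only [hn'.transfer_eq (by positivity) (by positivity) hG hfn]
    rw [Finset.sum_comm, Finset.mul_sum, ← Finset.sum_add_distrib]
    refine Finset.sum_congr rfl fun i _ => ?_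
    simp only [ExpMap.corr, hg, Function.iterate_zero, id]
    ring
  rw [hT]
  set A : ℕ → ℝ := fun d => ((K:ℝ) ^ n - 1)⁻¹ * transfer f^[n] (ExpMap.corr f g d) z with hAd
  set c : ℕ → ℝ := fun d => Emean f n (ExpMap.corr f g d) with hcd
  have hn0 : (0:ℝ) < n := by exact_mod_cast hn
  have hρn : 0 < (ρ ^ n)⁻¹ := by positivity
  have hpow : ∀ k, n ≤ 2 * k → C0 * (l ^ k)⁻¹ ≤ C0 * (ρ ^ n)⁻¹ := by
    intro k hk
    rw [hρl]
    have : ρ ^ n ≤ ρ ^ (2 * k) := pow_le_pow_right₀ hρ.le hk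
    gcongr
  have hcsym : ∀ d ≤ n, c d = c (n - d) := fun d hd => ExpMap.corr_symm hn g d hd
  have hA' : ∀ d ≤ n, |A d| ≤ C0 * (l ^ d)⁻¹ := hA
  have hcA' : ∀ d ≤ n, |c d - A d| ≤ C0 * (l ^ (n - d))⁻¹ := hcA
  have half : ∀ d, 2 * d ≤ n → |c d - A d - A (n - d)| ≤ 2 * C0 * (ρ ^ n)⁻¹ := by
    intro d hd
    have h1 := (hcA' d (by omega)).trans (hpow (n - d) (by omega))
    have h2 := (hA' (n - d) (by omega)).trans (hpow (n - d) (by omega))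
    have h3 := abs_sub (c d - A d) (A (n - d))
    linarith
  have full : ∀ d ∈ Finset.Ico 1 n, |c d - A d - A (n - d)| ≤ 2 * C0 * (ρ ^ n)⁻¹ := by
    intro d hd
    rw [Finset.mem_Ico] at hd
    rcases le_total (2 * d) n with hd2 | hd2
    · exact half d hd2
    · have := half (n - d) (by omega)
      rw [← hcsym d (by omega), show n - (n - d) = d by omega] at this
      rw [sub_right_comm]
      exact this
  have hflip : ∑ d ∈ Finset.Ico 1 n, A (n - d) = ∑ d ∈ Finset.Ico 1 n, A d := by
    refine Finset.sum_nbij' (fun d => n - d) (fun d => n - d) ?_ ?_ ?_ ?_ ?_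
    · intro d hd; simp only [Finset.mem_Ico] at *; omega
    · intro d hd; simp only [Finset.mem_Ico] at *; omega
    · intro d hd; simp only [Finset.mem_Ico] at *; omega
    · intro d hd; simp only [Finset.mem_Ico] at *; omega
    · intro d hd; rfl
  have h0 : |c 0 - A 0| ≤ C0 * (ρ ^ n)⁻¹ :=
    (hcA' 0 (by omega)).trans (hpow _ (by omega))
  have hsum : |∑ d ∈ Finset.Ico 1 n, (c d - A d - A (n - d))| ≤ (n - 1) * (2 * C0 * (ρ ^ n)⁻¹) := by
    refine (Finset.abs_sum_le_sum_abs _ _).trans ?_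
    refine (Finset.sum_le_card_nsmul _ _ _ full).trans ?_
    rw [Nat.card_Ico, nsmul_eq_mul]
    push_cast [hn]
    exact le_rfl
  have hrange : ∑ d ∈ Finset.range n, c d = c 0 + ∑ d ∈ Finset.Ico 1 n, c d := by
    rw [Finset.range_eq_Ico, Finset.sum_eq_sum_Ico_succ_bot (by omega)]
  rw [Finset.sum_sub_distrib, Finset.sum_sub_distrib, hflip] at hsum
  have htot : |∑ d ∈ Finset.range n, c d - (A 0 + 2 * ∑ d ∈ Finset.Ico 1 n, A d)| ≤
      n * (2 * C0 * (ρ ^ n)⁻¹) := by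
    rw [hrange]
    have := abs_add_le (c 0 - A 0) (∑ d ∈ Finset.Ico 1 n, c d - ∑ d ∈ Finset.Ico 1 n, A d
      - ∑ d ∈ Finset.Ico 1 n, A d)
    have e : (c 0 - A 0) + (∑ d ∈ Finset.Ico 1 n, c d - ∑ d ∈ Finset.Ico 1 n, A d
      - ∑ d ∈ Finset.Ico 1 n, A d) = c 0 + ∑ d ∈ Finset.Ico 1 n, c d -
        (A 0 + 2 * ∑ d ∈ Finset.Ico 1 n, A d) := by ring
    rw [e] at this
    have hp : 0 ≤ C0 * (ρ ^ n)⁻¹ := by positivity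
    linarith
  have hAsum : ((K : ℝ) ^ n - 1)⁻¹ * (n : ℝ)⁻¹ * (transfer f^[n] (ExpMap.corr f g 0) z +
        2 * ∑ j ∈ Finset.Ico 1 n, transfer f^[n] (ExpMap.corr f g j) z) =
      (n:ℝ)⁻¹ * (A 0 + 2 * ∑ d ∈ Finset.Ico 1 n, A d) := by
    simp only [hAd, ← Finset.mul_sum]
    ring
  rw [hAsum]
  have hE2 : (Emean f n g) ^ 2 ≤ C0 ^ 2 * (ρ ^ n)⁻¹ := by
    have h1 := hE.trans (hpow n (by omega))
    have h2 : (Emean f n g) ^ 2 ≤ (C0 * (ρ ^ n)⁻¹) ^ 2 := by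
      rw [← sq_abs]
      exact pow_le_pow_left₀ (abs_nonneg _) h1 2
    have h3 : (ρ ^ n)⁻¹ ≤ 1 := inv_le_one_of_one_le₀ (one_le_pow₀ hρ.le)
    have h4 : (C0 * (ρ ^ n)⁻¹) ^ 2 = C0 ^ 2 * (ρ ^ n)⁻¹ * (ρ ^ n)⁻¹ := by ring
    have h5 : C0 ^ 2 * (ρ ^ n)⁻¹ * (ρ ^ n)⁻¹ ≤ C0 ^ 2 * (ρ ^ n)⁻¹ * 1 := by gcongr
    linarith
  have hfin1 : |(n:ℝ)⁻¹ * ∑ d ∈ Finset.range n, c d - (Emean f n g) ^ 2 -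
      (n:ℝ)⁻¹ * (A 0 + 2 * ∑ d ∈ Finset.Ico 1 n, A d)| ≤ (2 * C0 + C0 ^ 2) * (ρ ^ n)⁻¹ := by
    have e : (n:ℝ)⁻¹ * ∑ d ∈ Finset.range n, c d - (Emean f n g) ^ 2 -
      (n:ℝ)⁻¹ * (A 0 + 2 * ∑ d ∈ Finset.Ico 1 n, A d) =
      (n:ℝ)⁻¹ * (∑ d ∈ Finset.range n, c d - (A 0 + 2 * ∑ d ∈ Finset.Ico 1 n, A d))
        - (Emean f n g) ^ 2 := by ring
    rw [e]
    refine (abs_sub _ _).trans ?_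
    rw [abs_mul, abs_of_pos (inv_pos.2 hn0), abs_of_nonneg (sq_nonneg (Emean f n g))]
    have h1 : (n:ℝ)⁻¹ * |∑ d ∈ Finset.range n, c d - (A 0 + 2 * ∑ d ∈ Finset.Ico 1 n, A d)|
        ≤ (n:ℝ)⁻¹ * (n * (2 * C0 * (ρ ^ n)⁻¹)) := by gcongr
    have h2 : (n:ℝ)⁻¹ * (n * (2 * C0 * (ρ ^ n)⁻¹)) = 2 * C0 * (ρ ^ n)⁻¹ := by
      field_simp
    linarith
  refine hfin1.trans ?_
  rw [le_div_iff₀ (by positivity)]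
  have h6 := mul_le_mul_of_nonneg_left (hs n) (by positivity : 0 ≤ 2 * C0 + C0 ^ 2)
  linarith
end
end

section
/- The limit σ² := lim_{n→∞} ∫ (ĥ² + 2·∑_{j=1}^{n-1} ĥ·(ĥ∘f^j)) dμ exists (equivalently, the series σ² = ∫ ĥ² dμ + 2·∑_{j=1}^{∞} ∫ ĥ·(ĥ∘f^j) dμ converges), and there exists a constant C > 0 such that for every integer n ≥ 1, |∫ (ĥ² + 2·∑_{j=1}^{n-1} ĥ·(ĥ∘f^j)) dμ − σ²| ≤ C/n. -/
open MeasureTheory Filter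

noncomputable section

def LipC (L : ℝ) (φ : AddCircle (1:ℝ) → ℝ) : Prop :=
  ∀ x y : ℝ, |φ (x : AddCircle (1:ℝ)) - φ (y : AddCircle (1:ℝ))| ≤ L * |x - y|

lemma circ_cont {X : Type*} [TopologicalSpace X] {φ : AddCircle (1:ℝ) → X}
    (h : Continuous (fun x : ℝ => φ (x : AddCircle (1:ℝ)))) : Continuous φ :=
  (QuotientAddGroup.isQuotientMap_mk (AddSubgroup.zmultiples (1:ℝ))).continuous_iff.2 h

lemma LipC.cont {L : ℝ} {φ : AddCircle (1:ℝ) → ℝ} (h : LipC L φ) : Continuous φ := by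
  apply circ_cont
  have : LipschitzWith (Real.toNNReal L) (fun x : ℝ => φ (x : AddCircle (1:ℝ))) := by
    apply LipschitzWith.of_dist_le_mul
    intro x y
    rw [Real.dist_eq, Real.dist_eq]
    refine (h x y).trans ?_
    gcongr
    exact Real.le_coe_toNNReal L
  exact this.continuous

lemma circ_int {φ : AddCircle (1:ℝ) → ℝ} (h : Continuous φ) (μ : Measure (AddCircle (1:ℝ)))
    [IsProbabilityMeasure μ] : Integrable φ μ := by
  have : Fact ((0:ℝ) < 1) := ⟨one_pos⟩
  exact h.integrable_of_hasCompactSupport (HasCompactSupport.of_compactSpace φ)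

lemma coe_eq_iff (x y : ℝ) : (x : AddCircle (1:ℝ)) = (y : AddCircle (1:ℝ)) ↔ ∃ n : ℤ, x = y + n := by
  rw [← sub_eq_zero, ← AddCircle.coe_sub, AddCircle.coe_eq_zero_iff]
  constructor
  · rintro ⟨n, hn⟩
    exact ⟨n, by simp at hn; linarith⟩
  · rintro ⟨n, hn⟩
    exact ⟨n, by simp; linarith⟩

lemma LipC.osc {L : ℝ} (hL : 0 ≤ L) {φ : AddCircle (1:ℝ) → ℝ} (h : LipC L φ) (a b : AddCircle (1:ℝ)) :
    |φ a - φ b| ≤ L := by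
  induction a using QuotientAddGroup.induction_on with | _ x => ?_
  induction b using QuotientAddGroup.induction_on with | _ y => ?_
  have hx : ((x : ℝ) : AddCircle (1:ℝ)) = (Int.fract x : ℝ) :=
    (coe_eq_iff _ _).2 ⟨⌊x⌋, (Int.fract_add_floor x).symm⟩
  have hy : ((y : ℝ) : AddCircle (1:ℝ)) = (Int.fract y : ℝ) :=
    (coe_eq_iff _ _).2 ⟨⌊y⌋, (Int.fract_add_floor y).symm⟩
  rw [hx, hy]
  refine (h _ _).trans ?_
  have : |Int.fract x - Int.fract y| ≤ 1 := by
    rw [abs_le]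
    constructor <;> linarith [Int.fract_nonneg x, Int.fract_nonneg y, Int.fract_lt_one x, Int.fract_lt_one y]
  nlinarith

lemma LipC.bound {L : ℝ} (hL : 0 ≤ L) {φ : AddCircle (1:ℝ) → ℝ} (h : LipC L φ)
    (μ : Measure (AddCircle (1:ℝ))) [IsProbabilityMeasure μ] (h0 : ∫ x, φ x ∂μ = 0)
    (a : AddCircle (1:ℝ)) : |φ a| ≤ L := by
  have h1 : ∫ x, (φ a - φ x) ∂μ = φ a := by
    rw [integral_sub (integrable_const _) (circ_int h.cont μ), h0]; simp
  have h2 : ‖∫ x, (φ a - φ x) ∂μ‖ ≤ L * μ.real Set.univ :=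
    norm_integral_le_of_norm_le_const (Eventually.of_forall fun x => h.osc hL a x)
  rw [h1] at h2
  simpa using h2

lemma exists_inv
    (F : ℝ → ℝ)
    (hF : ContDiff ℝ 2 F)
    (lam : ℝ)
    (hlam : 1 < lam)
    (hexp : ∀ x : ℝ, lam ≤ deriv F x)
    : ∃ G : ℝ → ℝ, (∀ x, F (G x) = x) ∧ (∀ x, G (F x) = x) ∧
    ∀ x y, |G x - G y| ≤ lam⁻¹ * |x - y| := by
  have key := mul_sub_le_image_sub_of_le_deriv (hF.differentiable (by norm_num)) hexp
  have hl : 0 < lam := by linarith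
  have hs : Function.Surjective F := by
    apply hF.continuous.surjective
    · refine tendsto_atTop_mono' _ (f₁ := fun x => lam * x + F 0) ?_ ?_
      · filter_upwards [eventually_ge_atTop 0] with x hx
        linarith [key hx]
      · exact tendsto_atTop_add_const_right _ _ (tendsto_id.const_mul_atTop hl)
    · refine tendsto_atBot_mono' _ (f₁ := fun x => lam * x + F 0) ?_ ?_
      · filter_upwards [eventually_le_atBot 0] with x hx
        linarith [key hx]
      · exact tendsto_atBot_add_const_right _ _ (tendsto_id.const_mul_atBot hl)
  have hexp2 : ∀ a b, lam * |a - b| ≤ |F a - F b| := by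
    intro a b
    rcases le_total a b with h | h
    · rw [abs_sub_comm, abs_sub_comm (F a), abs_of_nonneg (sub_nonneg.2 h)]
      exact (key h).trans (le_abs_self _)
    · rw [abs_of_nonneg (sub_nonneg.2 h)]
      exact (key h).trans (le_abs_self _)
  have hr := Function.surjInv_eq hs
  refine ⟨Function.surjInv hs, hr, ?_, ?_⟩
  · intro x
    have := hexp2 (Function.surjInv hs (F x)) x
    rw [hr, sub_self, abs_zero] at this
    have h3 : |Function.surjInv hs (F x) - x| ≤ 0 := by
      by_contra h; push Not at h; nlinarith
    exact sub_eq_zero.1 (abs_nonpos_iff.1 h3)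
  · intro x y
    have := hexp2 (Function.surjInv hs x) (Function.surjInv hs y)
    rw [hr, hr] at this
    rw [inv_mul_eq_div, le_div_iff₀ hl]; linarith

lemma F_int
    (K : ℕ)
    (F : ℝ → ℝ)
    (hdeg : ∀ x : ℝ, F (x + 1) = F x + K)
    (n : ℤ) (x : ℝ) : F (x + n) = F x + K * n := by
  have hp : Function.Periodic (fun x => F x - K * x) 1 := by
    intro x; simp only [hdeg]; ring
  have := hp.int_mul n x
  simp only [mul_one] at this
  linarith

lemma transfer_eq
    (K : ℕ)
    (hK : 2 ≤ K)
    (F : ℝ → ℝ)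
    (hdeg : ∀ x : ℝ, F (x + 1) = F x + K)
    (f : AddCircle (1:ℝ) → AddCircle (1:ℝ))
    (hfF : ∀ x : ℝ, f (x : AddCircle (1:ℝ)) = ((F x : ℝ) : AddCircle (1:ℝ)))
    (G : ℝ → ℝ) (hFG : ∀ x, F (G x) = x) (hGF : ∀ x, G (F x) = x)
    (φ : AddCircle (1:ℝ) → ℝ) (x : ℝ) :
    transfer f φ (x : AddCircle (1:ℝ)) =
      ∑ i ∈ Finset.range K, φ ((G (x + i) : ℝ) : AddCircle (1:ℝ)) := by
  have hset : f ⁻¹' {(x : AddCircle (1:ℝ))} =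
      (fun i : ℕ => ((G (x + i) : ℝ) : AddCircle (1:ℝ))) '' (Finset.range K : Set ℕ) := by
    ext y
    induction y using QuotientAddGroup.induction_on with | _ t => ?_
    simp only [Set.mem_preimage, Set.mem_singleton_iff, Set.mem_image, Finset.coe_range, Set.mem_Iio]
    rw [show f (QuotientAddGroup.mk t) = _ from hfF t]
    constructor
    · intro h
      obtain ⟨m, hm⟩ := (coe_eq_iff _ _).1 h
      have hK0 : (0:ℤ) < K := by omega
      have h1 := Int.emod_add_mul_ediv m K
      have h2 := Int.emod_nonneg m hK0.ne'
      have h3 := Int.emod_lt_of_pos m hK0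
      obtain ⟨i, hi⟩ := Int.eq_ofNat_of_zero_le h2
      refine ⟨i, by omega, ?_⟩
      have h4 : F (t + ((-(m / K) : ℤ) : ℝ)) = x + i := by
        rw [F_int K F hdeg, hm, add_assoc]
        congr 1
        have : (i : ℤ) + K * (m / K) = m := by rw [← hi]; exact h1
        have h5 : ((i:ℝ) + K * ((m / K : ℤ) : ℝ)) = m := by exact_mod_cast this
        rw [← h5]; push_cast; ring
      rw [← h4, hGF]
      exact (coe_eq_iff _ _).2 ⟨_, rfl⟩
    · rintro ⟨i, _, h⟩
      rw [← hfF]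
      rw [← h, hfF, hFG]
      exact (coe_eq_iff _ _).2 ⟨i, by simp⟩
  have hinj : Set.InjOn (fun i : ℕ => ((G (x + i) : ℝ) : AddCircle (1:ℝ))) (Finset.range K : Set ℕ) := by
    intro i hi j hj h
    simp only [Finset.coe_range, Set.mem_Iio] at hi hj
    obtain ⟨n, hn⟩ := (coe_eq_iff _ _).1 h
    have h1 : F (G (x + i)) = F (G (x + j) + n) := by rw [hn]
    rw [F_int K F hdeg, hFG, hFG] at h1
    have h2 : (i : ℤ) = j + K * n := by
      have : (i : ℝ) = j + K * n := by linarith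
      exact_mod_cast this
    have h3 : n = 0 := by
      by_contra h0
      rcases lt_or_gt_of_ne h0 with h4 | h4
      · have : (K:ℤ) * n ≤ K * (-1) := by gcongr; omega
        omega
      · have : (K:ℤ) * 1 ≤ K * n := by gcongr; omega
        omega
    subst h3
    simp at h2
    exact h2
  unfold transfer
  rw [hset, finsum_mem_image hinj, finsum_mem_coe_finset]

lemma transfer_lip
    (K : ℕ)
    (hK : 2 ≤ K)
    (F : ℝ → ℝ)
    (hF : ContDiff ℝ 2 F)
    (hdeg : ∀ x : ℝ, F (x + 1) = F x + K)
    (lam : ℝ)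
    (hlam : 1 < lam)
    (hexp : ∀ x : ℝ, lam ≤ deriv F x)
    (f : AddCircle (1:ℝ) → AddCircle (1:ℝ))
    (hfF : ∀ x : ℝ, f (x : AddCircle (1:ℝ)) = ((F x : ℝ) : AddCircle (1:ℝ)))
    {L : ℝ} (hL : 0 ≤ L) {φ : AddCircle (1:ℝ) → ℝ} (h : LipC L φ) :
    LipC (L * lam⁻¹) (fun x => (K:ℝ)⁻¹ * transfer f φ x) := by
  obtain ⟨G, hFG, hGF, hG⟩ := exists_inv F hF lam hlam hexp
  intro x y
  have hK0 : (0:ℝ) < K := by exact_mod_cast (by omega : 0 < K)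
  simp only [transfer_eq K hK F hdeg f hfF G hFG hGF]
  rw [← mul_sub, ← Finset.sum_sub_distrib, abs_mul, abs_of_pos (inv_pos.2 hK0), inv_mul_le_iff₀ hK0]
  refine (Finset.abs_sum_le_sum_abs _ _).trans ?_
  refine (Finset.sum_le_card_nsmul _ _ (L * lam⁻¹ * |x - y|) ?_).trans ?_
  · intro i _
    refine (h _ _).trans ?_
    rw [mul_assoc]
    gcongr
    refine (hG _ _).trans (le_of_eq ?_)
    congr 2; ring
  · simp

lemma transfer_mul
    (K : ℕ)
    (hK : 2 ≤ K)
    (F : ℝ → ℝ)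
    (hF : ContDiff ℝ 2 F)
    (hdeg : ∀ x : ℝ, F (x + 1) = F x + K)
    (lam : ℝ)
    (hlam : 1 < lam)
    (hexp : ∀ x : ℝ, lam ≤ deriv F x)
    (f : AddCircle (1:ℝ) → AddCircle (1:ℝ))
    (hfF : ∀ x : ℝ, f (x : AddCircle (1:ℝ)) = ((F x : ℝ) : AddCircle (1:ℝ)))
    (φ ψ : AddCircle (1:ℝ) → ℝ) (a : AddCircle (1:ℝ)) :
    transfer f (fun x => φ x * ψ (f x)) a = transfer f φ a * ψ a := by
  obtain ⟨G, hFG, hGF, hG⟩ := exists_inv F hF lam hlam hexp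
  induction a using QuotientAddGroup.induction_on with | _ x => ?_
  rw [transfer_eq K hK F hdeg f hfF G hFG hGF, transfer_eq K hK F hdeg f hfF G hFG hGF, Finset.sum_mul]
  refine Finset.sum_congr rfl fun i _ => ?_
  rw [hfF, hFG]
  congr 2
  exact (coe_eq_iff _ _).2 ⟨i, by simp⟩

lemma f_cont
    (F : ℝ → ℝ)
    (hF : ContDiff ℝ 2 F)
    (f : AddCircle (1:ℝ) → AddCircle (1:ℝ))
    (hfF : ∀ x : ℝ, f (x : AddCircle (1:ℝ)) = ((F x : ℝ) : AddCircle (1:ℝ)))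
    : Continuous f := by
  apply circ_cont
  simp only [hfF]
  exact (AddCircle.continuous_mk' (1:ℝ)).comp hF.continuous

lemma decay
    (K : ℕ)
    (hK : 2 ≤ K)
    (F : ℝ → ℝ)
    (hF : ContDiff ℝ 2 F)
    (hdeg : ∀ x : ℝ, F (x + 1) = F x + K)
    (lam : ℝ)
    (hlam : 1 < lam)
    (hexp : ∀ x : ℝ, lam ≤ deriv F x)
    (f : AddCircle (1:ℝ) → AddCircle (1:ℝ))
    (hfF : ∀ x : ℝ, f (x : AddCircle (1:ℝ)) = ((F x : ℝ) : AddCircle (1:ℝ)))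
    (μ : Measure (AddCircle (1:ℝ))) [IsProbabilityMeasure μ]
    (hμ : ∀ φ : AddCircle (1:ℝ) → ℝ, Continuous φ →
      ∫ x, transfer f φ x ∂μ = (K : ℝ) * ∫ x, φ x ∂μ)
    (ψ : AddCircle (1:ℝ) → ℝ) (hψ : Continuous ψ) (M : ℝ) (hM : ∀ x, |ψ x| ≤ M) (j : ℕ) :
    ∀ (L : ℝ) (_ : 0 ≤ L) (φ : AddCircle (1:ℝ) → ℝ) (_ : LipC L φ) (_ : ∫ x, φ x ∂μ = 0),
    |∫ x, φ x * ψ (f^[j] x) ∂μ| ≤ L * M * lam⁻¹ ^ j := by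
  have hK0 : (0:ℝ) < K := by exact_mod_cast (by omega : 0 < K)
  have hl : 0 < lam := by linarith
  have hfc := f_cont F hF f hfF
  induction j with
  | zero =>
    intro L hL φ h h0
    have h2 : ‖∫ x, φ x * ψ (f^[0] x) ∂μ‖ ≤ (L * M) * μ.real Set.univ := by
      refine norm_integral_le_of_norm_le_const (Eventually.of_forall fun x => ?_)
      rw [norm_mul]
      exact mul_le_mul (h.bound hL μ h0 x) (hM _) (abs_nonneg _) hL
    simpa using h2
  | succ j ih =>
    intro L hL φ h h0
    have h1 := ih (L * lam⁻¹) (by positivity) _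
      (transfer_lip K hK F hF hdeg lam hlam hexp f hfF hL h)
      (by rw [integral_const_mul, hμ φ h.cont, h0]; simp)
    have h2 := hμ (fun x => φ x * ψ (f^[j] (f x)))
      (h.cont.mul (hψ.comp ((hfc.iterate j).comp hfc)))
    have h3 : ∀ x, transfer f (fun x => φ x * ψ (f^[j] (f x))) x = transfer f φ x * ψ (f^[j] x) :=
      transfer_mul K hK F hF hdeg lam hlam hexp f hfF φ (fun x => ψ (f^[j] x))
    simp only [h3] at h2
    have h4 : ∫ x, φ x * ψ (f^[j+1] x) ∂μ =
        ∫ x, (K:ℝ)⁻¹ * transfer f φ x * ψ (f^[j] x) ∂μ := by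
      simp only [Function.iterate_succ_apply, mul_assoc]
      rw [integral_const_mul, h2]
      field_simp
    rw [h4]
    refine h1.trans (le_of_eq ?_)
    rw [pow_succ]; ring

lemma log_lip
    (K : ℕ)
    (F : ℝ → ℝ)
    (hF : ContDiff ℝ 2 F)
    (hdeg : ∀ x : ℝ, F (x + 1) = F x + K)
    (lam : ℝ)
    (hlam : 1 < lam)
    (hexp : ∀ x : ℝ, lam ≤ deriv F x)
    (f' : AddCircle (1:ℝ) → ℝ)
    (hf'F : ∀ x : ℝ, f' (x : AddCircle (1:ℝ)) = deriv F x) :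
    ∃ L : ℝ, 0 ≤ L ∧ LipC L (fun x => Real.log (f' x)) := by
  have hpos : ∀ x, deriv F x ≠ 0 := fun x => by linarith [hexp x]
  have hd : ContDiff ℝ 1 (deriv F) := hF.deriv'
  have hc : ContDiff ℝ 1 (fun x => Real.log (deriv F x)) := hd.log hpos
  have hper : Function.Periodic (deriv F) 1 := by
    intro x
    rw [← deriv_comp_add_const]
    simp only [hdeg]
    simp
  have hper2 : Function.Periodic (deriv (fun x => Real.log (deriv F x))) 1 := by
    intro x
    rw [← deriv_comp_add_const]
    congr 1
    ext y
    rw [hper y]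
  have hb := hper2.isBounded_of_continuous one_ne_zero (hc.continuous_deriv le_rfl)
  obtain ⟨L, hL⟩ := hb.exists_norm_le
  refine ⟨L, (norm_nonneg _).trans (hL _ ⟨0, rfl⟩), ?_⟩
  intro x y
  simp only [hf'F]
  exact Convex.norm_image_sub_le_of_norm_deriv_le (s := Set.univ)
    (fun x _ => hc.differentiable (by norm_num) x) (fun x _ => hL _ ⟨x, rfl⟩) convex_univ
    (Set.mem_univ _) (Set.mem_univ _)

lemma series_part (I0 A r : ℝ) (hA : 0 ≤ A) (hr0 : 0 < r) (hr : r < 1) (c S : ℕ → ℝ)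
    (hc : ∀ j, |c j| ≤ A * r ^ j) (hS : ∀ n, S (n + 1) = I0 + 2 * ∑ j ∈ Finset.range n, c j) :
    ∃ s, Tendsto S atTop (nhds s) ∧ Summable c ∧ s = I0 + 2 * ∑' j, c j ∧
      ∃ C : ℝ, 0 < C ∧ ∀ n : ℕ, 1 ≤ n → |S n - s| ≤ C / (n : ℝ) := by
  have hg : HasSum (fun j => A * r ^ j) (A * (1 - r)⁻¹) :=
    (hasSum_geometric_of_lt_one hr0.le hr).mul_left A
  have hsum : Summable c := Summable.of_norm_bounded hg.summable hc
  refine ⟨_, ?_, hsum, rfl, ?_⟩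
  · rw [← tendsto_add_atTop_iff_nat 1]
    simp only [hS]
    exact (hsum.hasSum.tendsto_sum_nat.const_mul 2).const_add I0
  · have h1r : 0 < 1 - r := by linarith
    refine ⟨2 * (A * (1 - r)⁻¹) * (1 / (1 - r)) + 1, by positivity, ?_⟩
    intro n hn
    obtain ⟨m, rfl⟩ : ∃ m, n = m + 1 := ⟨n - 1, by omega⟩
    rw [hS, ← hsum.sum_add_tsum_nat_add m]
    have ht : ‖∑' i, c (i + m)‖ ≤ (A * (1 - r)⁻¹) * r ^ m := by
      refine tsum_of_norm_bounded (hg.mul_right (r ^ m)) fun i => ?_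
      refine (hc _).trans (le_of_eq ?_)
      rw [pow_add]; ring
    have e : I0 + 2 * ∑ j ∈ Finset.range m, c j -
        (I0 + 2 * (∑ j ∈ Finset.range m, c j + ∑' i, c (i + m))) = -(2 * ∑' i, c (i + m)) := by ring
    rw [e, abs_neg, abs_mul, abs_two, le_div_iff₀ (by positivity)]
    rw [Real.norm_eq_abs] at ht
    have hb : r ^ m * (m + 1) ≤ 1 / (1 - r) := by
      have h2 : ∀ m : ℕ, r ^ m * (m + 1) ≤ ∑ j ∈ Finset.range (m + 1), r ^ j := by
        intro m
        have := Finset.card_nsmul_le_sum (Finset.range (m + 1)) (fun j => r ^ j) (r ^ m) (by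
          intro j hj
          exact pow_le_pow_of_le_one hr0.le hr.le (by simp at hj; omega))
        simp at this
        linarith
      refine (h2 m).trans ?_
      rw [one_div]
      have hh := hasSum_geometric_of_lt_one hr0.le hr
      exact sum_le_hasSum _ (fun i _ => by positivity) hh
    push_cast
    have hB : 0 ≤ A * (1 - r)⁻¹ := by positivity
    calc 2 * |∑' i, c (i + m)| * ((m:ℝ) + 1) ≤ 2 * (A * (1 - r)⁻¹ * r ^ m) * ((m:ℝ) + 1) := by gcongr
      _ = 2 * (A * (1 - r)⁻¹) * (r ^ m * (m + 1)) := by ring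
      _ ≤ 2 * (A * (1 - r)⁻¹) * (1 / (1 - r)) := by gcongr
      _ ≤ _ := by linarith

/-- Existence of the asymptotic variance: the integrals
`∫ (ĥ² + 2∑_{j=1}^{n-1} ĥ·(ĥ∘f^j)) dμ` converge to a limit `σ²` (equivalently, the
series `∫ĥ²dμ + 2∑_{j≥1}∫ĥ·(ĥ∘f^j)dμ` converges), with rate `C/n`. -/
theorem stmt10
    (K : ℕ) (hK : 2 ≤ K)
    (F : ℝ → ℝ) (hF : ContDiff ℝ 2 F)
    (hdeg : ∀ x : ℝ, F (x + 1) = F x + K)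
    (lam : ℝ) (hlam : 1 < lam)
    (hexp : ∀ x : ℝ, lam ≤ deriv F x)
    (f : AddCircle (1:ℝ) → AddCircle (1:ℝ))
    (hfF : ∀ x : ℝ, f (x : AddCircle (1:ℝ)) = ((F x : ℝ) : AddCircle (1:ℝ)))
    (f' : AddCircle (1:ℝ) → ℝ)
    (hf'F : ∀ x : ℝ, f' (x : AddCircle (1:ℝ)) = deriv F x)
    (μ : Measure (AddCircle (1:ℝ))) [IsProbabilityMeasure μ]
    (hinv : ∀ φ : AddCircle (1:ℝ) → ℝ, Continuous φ → ∫ x, φ (f x) ∂μ = ∫ x, φ x ∂μ)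
    (hμ : ∀ φ : AddCircle (1:ℝ) → ℝ, Continuous φ → ∫ x, transfer f φ x ∂μ = (K : ℝ) * ∫ x, φ x ∂μ)
    :
    ∃ sigma2 : ℝ,
      Tendsto (fun n : ℕ =>
          ∫ x, ((Real.log (f' x) - ∫ y, Real.log (f' y) ∂μ) ^ 2 +
            2 * ∑ j ∈ Finset.Ico 1 n,
              (Real.log (f' x) - ∫ y, Real.log (f' y) ∂μ) *
                (Real.log (f' (f^[j] x)) - ∫ y, Real.log (f' y) ∂μ)) ∂μ)
        atTop (nhds sigma2) ∧
      Summable (fun j : ℕ => ∫ x, (Real.log (f' x) - ∫ y, Real.log (f' y) ∂μ) *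
        (Real.log (f' (f^[j + 1] x)) - ∫ y, Real.log (f' y) ∂μ) ∂μ) ∧
      sigma2 = (∫ x, (Real.log (f' x) - ∫ y, Real.log (f' y) ∂μ) ^ 2 ∂μ) +
        2 * ∑' j : ℕ, ∫ x, (Real.log (f' x) - ∫ y, Real.log (f' y) ∂μ) *
          (Real.log (f' (f^[j + 1] x)) - ∫ y, Real.log (f' y) ∂μ) ∂μ ∧
      ∃ C : ℝ, 0 < C ∧ ∀ n : ℕ, 1 ≤ n →
        |(∫ x, ((Real.log (f' x) - ∫ y, Real.log (f' y) ∂μ) ^ 2 +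
            2 * ∑ j ∈ Finset.Ico 1 n,
              (Real.log (f' x) - ∫ y, Real.log (f' y) ∂μ) *
                (Real.log (f' (f^[j] x)) - ∫ y, Real.log (f' y) ∂μ)) ∂μ) - sigma2| ≤
          C / (n : ℝ) := by
  obtain ⟨L, hL, hlip⟩ := log_lip K F hF hdeg lam hlam hexp f' hf'F
  set m := ∫ y, Real.log (f' y) ∂μ with hm
  have hfc := f_cont F hF f hfF
  have hlip2 : LipC L (fun x => Real.log (f' x) - m) := by
    intro x y
    have := hlip x y
    simpa using this
  have hcont := hlip2.cont
  have h0 : ∫ x, (Real.log (f' x) - m) ∂μ = 0 := by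
    rw [integral_sub (circ_int hlip.cont μ) (integrable_const _)]; simp [hm]
  have hl : 0 < lam := by linarith
  refine series_part _ (L * L * lam⁻¹) lam⁻¹ (by positivity) (by positivity)
    (inv_lt_one_of_one_lt₀ hlam) _ _ ?_ ?_
  · intro j
    have := decay K hK F hF hdeg lam hlam hexp f hfF μ hμ _ hcont L (hlip2.bound hL μ h0) (j + 1)
      L hL _ hlip2 h0
    refine this.trans (le_of_eq ?_)
    rw [pow_succ]; ring
  · intro n
    have hi : ∀ j : ℕ, Integrable (fun x => (Real.log (f' x) - m) * (Real.log (f' (f^[j] x)) - m)) μ :=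
      fun j => circ_int (hcont.mul (hcont.comp (hfc.iterate j))) μ
    have hsq : Integrable (fun x => (Real.log (f' x) - m) ^ 2) μ := circ_int (hcont.pow 2) μ
    rw [integral_add hsq
      ((integrable_finsetSum _ fun j _ => hi j).const_mul 2), integral_const_mul,
      integral_finsetSum _ fun j _ => hi j, Finset.sum_Ico_eq_sum_range]
    simp only [Nat.add_sub_cancel, add_comm 1]
end
end
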